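/- Let Γ be a subgroup of Diff^ω₊(S¹) which is locally nondiscrete with respect to the C¹-topology, and assume that there exists no Γ-invariant Borel probability measure on the circle. Then the image ρ(Γ) of Γ under the rotation number function is an infinite subset of ℝ/ℤ; moreover there exists a sequence {fᵢ} of elements of Γ such that ρ(fᵢ) ≠ 0 for every i and ρ(fᵢ) → 0 as i → ∞. -/

import Mathlib

open Filter Topology Set MeasureTheory Classical

noncomputable section

/-- The circle `S¹ = ℝ/ℤ`. -/
abbrev S1 := AddCircle (1 : ℝ)

/-- The group of homeomorphisms of the circle (composition as multiplication). -/
instance : Group (S1 ≃ₜ S1) where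
  mul f g := g.trans f
  one := Homeomorph.refl _
  inv := Homeomorph.symm
  mul_assoc f g h := rfl
  one_mul f := Homeomorph.ext fun _ => rfl
  mul_one f := Homeomorph.ext fun _ => rfl
  inv_mul_cancel f := Homeomorph.ext fun x => f.symm_apply_apply x

/-- `F` is a lift of the circle map `f` to the real line. -/
def IsLiftOf (F : CircleDeg1Lift) (f : S1 ≃ₜ S1) : Prop :=
  ∀ x : ℝ, f (x : S1) = ((F x : ℝ) : S1)

/-- `f` is an orientation-preserving homeomorphism of the circle: it admits a lift to
a monotone homeomorphism of `ℝ` commuting with integer translations. -/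
def OrientationPreserving (f : S1 ≃ₜ S1) : Prop :=
  ∃ F : CircleDeg1Liftˣ, IsLiftOf (F : CircleDeg1Lift) f

/-- The rotation number `ρ(f) ∈ ℝ/ℤ` of an orientation-preserving circle homeomorphism:
the translation number of a lift, taken modulo `ℤ` (independent of the lift). -/
def rotationNumber (f : S1 ≃ₜ S1) : AddCircle (1 : ℝ) :=
  if h : ∃ F : CircleDeg1Liftˣ, IsLiftOf (F : CircleDeg1Lift) f then
    (((h.choose : CircleDeg1Lift).translationNumber : ℝ) : AddCircle (1 : ℝ))
  else 0

/-- The orbit of `x` under a subgroup `Γ` of circle homeomorphisms. -/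
def circleOrbit (Γ : Subgroup (S1 ≃ₜ S1)) (x : S1) : Set S1 :=
  {y : S1 | ∃ γ ∈ Γ, γ x = y}

/-- `Γ` has a finite orbit. -/
def HasFiniteOrbit (Γ : Subgroup (S1 ≃ₜ S1)) : Prop :=
  ∃ x : S1, (circleOrbit Γ x).Finite

/-- `f` is an orientation-preserving real analytic diffeomorphism of the circle: it has a
lift which is a real analytic map `ℝ → ℝ` with everywhere positive derivative. -/
def IsAnalyticDiffeo (f : S1 ≃ₜ S1) : Prop :=
  ∃ F : CircleDeg1Liftˣ, IsLiftOf (F : CircleDeg1Lift) f ∧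
    AnalyticOnNhd ℝ (⇑(F : CircleDeg1Lift)) Set.univ ∧
    ∀ x : ℝ, 0 < deriv (⇑(F : CircleDeg1Lift)) x

/-- `Γ` is nondiscrete with respect to the `C¹`-topology: there is a sequence of elements of
`Γ ∖ {id}` converging to the identity in the `C¹`-topology (expressed via lifts). -/
def C1Nondiscrete (Γ : Subgroup (S1 ≃ₜ S1)) : Prop :=
  ∃ (f : ℕ → S1 ≃ₜ S1) (F : ℕ → CircleDeg1Liftˣ),
    (∀ n, f n ∈ Γ ∧ f n ≠ 1 ∧ IsLiftOf (F n : CircleDeg1Lift) (f n)) ∧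
    ∀ ε : ℝ, 0 < ε → ∃ N : ℕ, ∀ n ≥ N, ∀ x : ℝ,
      |(F n : CircleDeg1Lift) x - x| < ε ∧ |deriv (⇑(F n : CircleDeg1Lift)) x - 1| < ε

/-- `Γ` is locally nondiscrete with respect to the `C¹`-topology: some sequence of elements of
`Γ ∖ {id}` converges to the identity in the `C¹`-topology on some open interval of the circle
(an interval is described by a lift chart `]a, b[` with `b ≤ a + 1`). -/
def LocallyC1Nondiscrete (Γ : Subgroup (S1 ≃ₜ S1)) : Prop :=
  ∃ a b : ℝ, a < b ∧ b ≤ a + 1 ∧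
    ∃ (f : ℕ → S1 ≃ₜ S1) (F : ℕ → CircleDeg1Liftˣ),
      (∀ n, f n ∈ Γ ∧ f n ≠ 1 ∧ IsLiftOf (F n : CircleDeg1Lift) (f n)) ∧
      ∀ ε : ℝ, 0 < ε → ∃ N : ℕ, ∀ n ≥ N, ∀ x ∈ Ioo a b,
        |(F n : CircleDeg1Lift) x - x| < ε ∧ |deriv (⇑(F n : CircleDeg1Lift)) x - 1| < ε

/-- `Γ` is locally nondiscrete with respect to the `C⁰`-topology. -/
def LocallyC0Nondiscrete (Γ : Subgroup (S1 ≃ₜ S1)) : Prop :=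
  ∃ a b : ℝ, a < b ∧ b ≤ a + 1 ∧
    ∃ (f : ℕ → S1 ≃ₜ S1) (F : ℕ → CircleDeg1Liftˣ),
      (∀ n, f n ∈ Γ ∧ f n ≠ 1 ∧ IsLiftOf (F n : CircleDeg1Lift) (f n)) ∧
      ∀ ε : ℝ, 0 < ε → ∃ N : ℕ, ∀ n ≥ N, ∀ x ∈ Ioo a b,
        |(F n : CircleDeg1Lift) x - x| < ε

/-- There is a `Γ`-invariant Borel probability measure on the circle. -/
def HasInvariantProbMeasure (Γ : Subgroup (S1 ≃ₜ S1)) : Prop :=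
  ∃ μ : Measure S1, IsProbabilityMeasure μ ∧ ∀ γ ∈ Γ, Measure.map (⇑γ) μ = μ

/-- `Γ` is minimal: every orbit is dense in the circle. -/
def IsMinimalSubgroup (Γ : Subgroup (S1 ≃ₜ S1)) : Prop :=
  ∀ x : S1, Dense (circleOrbit Γ x)

/-- The closed arc `π([a, b])` of the circle. -/
def closedArc (a b : ℝ) : Set S1 :=
  (fun x : ℝ => (x : S1)) '' Icc a b

/-- The closed arc `π([a,b])` is `Γ`-contractible: some sequence `gₙ ∈ Γ` shrinks its
length to zero (lengths are measured via orientation-preserving lifts). -/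
def ContractibleArc (Γ : Subgroup (S1 ≃ₜ S1)) (a b : ℝ) : Prop :=
  ∃ (g : ℕ → S1 ≃ₜ S1) (G : ℕ → CircleDeg1Liftˣ),
    (∀ n, g n ∈ Γ ∧ IsLiftOf (G n : CircleDeg1Lift) (g n)) ∧
    Tendsto (fun n => (G n : CircleDeg1Lift) b - (G n : CircleDeg1Lift) a) atTop (𝓝 0)

/-- `Φ` is a local flow of the vector field `X` on the set `K` for times `0 ≤ t ≤ t₀`,
staying inside the domain `dom` of `X`. -/
def IsLocalFlowOn (X : ℝ → ℝ) (dom : Set ℝ) (Φ : ℝ → ℝ → ℝ) (K : Set ℝ) (t₀ : ℝ) : Prop :=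
  (∀ x ∈ K, Φ 0 x = x) ∧
  ∀ x ∈ K, ∀ t ∈ Icc (0 : ℝ) t₀, Φ t x ∈ dom ∧
    HasDerivWithinAt (fun s => Φ s x) (X (Φ t x)) (Icc (0 : ℝ) t₀) t

/-- The local vector field `X` on the open interval `]a,b[` (in a lift chart of the circle)
is in the `C⁰`-closure of `Γ` relative to this interval: every time-`t₀` map of its local flow
defined on a compact subinterval is a uniform limit of (lifts of) elements of `Γ`. -/
def InC0Closure (Γ : Subgroup (S1 ≃ₜ S1)) (a b : ℝ) (X : ℝ → ℝ) : Prop :=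
  ∀ c d : ℝ, a < c → c ≤ d → d < b →
    ∀ t₀ : ℝ, 0 < t₀ → ∀ Φ : ℝ → ℝ → ℝ,
      IsLocalFlowOn X (Ioo a b) Φ (Icc c d) t₀ →
      ∃ (γ : ℕ → S1 ≃ₜ S1) (G : ℕ → CircleDeg1Liftˣ),
        (∀ n, γ n ∈ Γ ∧ IsLiftOf (G n : CircleDeg1Lift) (γ n)) ∧
        TendstoUniformlyOn (fun n x => (G n : CircleDeg1Lift) x) (fun x => Φ t₀ x)
          atTop (Icc c d)



namespace RotImg

/-- Lifts, seen as functions `ℝ → ℝ`. -/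
instance instCoeFunLift : CoeFun CircleDeg1Liftˣ (fun _ => ℝ → ℝ) :=
  ⟨fun F => ⇑(F : CircleDeg1Lift)⟩

abbrev Lf := CircleDeg1Liftˣ

theorem lmul (F G : Lf) (x : ℝ) : (F * G : Lf) x = F (G x) := rfl

theorem lone (x : ℝ) : (1 : Lf) x = x := rfl

theorem linv (F : Lf) (x : ℝ) : (F⁻¹ : Lf) (F x) = x :=
  CircleDeg1Lift.units_inv_apply_apply F x

theorem linv' (F : Lf) (x : ℝ) : F ((F⁻¹ : Lf) x) = x :=
  CircleDeg1Lift.units_apply_inv_apply F x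

theorem lstrict (F : Lf) : StrictMono (F : ℝ → ℝ) := by
  have := (CircleDeg1Lift.toOrderIso F).strictMono
  rwa [CircleDeg1Lift.coe_toOrderIso] at this

theorem llt (F : Lf) {x y : ℝ} : F x < F y ↔ x < y := (lstrict F).lt_iff_lt

theorem lle (F : Lf) {x y : ℝ} : F x ≤ F y ↔ x ≤ y := (lstrict F).le_iff_le

theorem lcont (F : Lf) : Continuous (F : ℝ → ℝ) := by
  have := (CircleDeg1Lift.toOrderIso F).continuous
  rwa [CircleDeg1Lift.coe_toOrderIso] at this

theorem ladd1 (F : Lf) (x : ℝ) : F (x + 1) = F x + 1 := CircleDeg1Lift.map_add_one _ x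

theorem laddz (F : Lf) (x : ℝ) (n : ℤ) : F (x + n) = F x + n := CircleDeg1Lift.map_add_int _ x n

theorem lext {F G : Lf} (h : ∀ x, F x = G x) : F = G :=
  Units.ext (CircleDeg1Lift.ext h)

theorem lpow (F : Lf) (n : ℕ) : ((F ^ n : Lf) : ℝ → ℝ) = (F : ℝ → ℝ)^[n] := by
  have := CircleDeg1Lift.coe_pow (F : CircleDeg1Lift) n
  rw [← this, Units.val_pow_eq_pow_val]

theorem lpow_succ (F : Lf) (n : ℕ) (x : ℝ) : (F ^ (n + 1) : Lf) x = F ((F ^ n : Lf) x) := by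
  rw [pow_succ']; rfl

theorem lpow_succ' (F : Lf) (n : ℕ) (x : ℝ) : (F ^ (n + 1) : Lf) x = (F ^ n : Lf) (F x) := by
  rw [pow_succ]; rfl

theorem lpow_fix (F : Lf) {x : ℝ} (h : F x = x) (n : ℕ) : (F ^ n : Lf) x = x := by
  induction n with
  | zero => rfl
  | succ k ih => rw [lpow_succ, ih, h]

/-- integer translation -/
def trans (n : ℤ) : Lf := CircleDeg1Lift.translate (Multiplicative.ofAdd (n : ℝ))

theorem trans_apply (n : ℤ) (x : ℝ) : trans n x = x + n := by
  rw [trans, CircleDeg1Lift.translate_apply, add_comm]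

/-- The standing assumption on a group of lifts. -/
structure Good (L : Subgroup Lf) : Prop where
  an : ∀ F ∈ L, AnalyticOnNhd ℝ (F : ℝ → ℝ) univ
  dpos : ∀ F ∈ L, ∀ x, 0 < deriv (F : ℝ → ℝ) x
  tr : ∀ n : ℤ, trans n ∈ L

theorem Good.diff {L : Subgroup Lf} (h : Good L) {F : Lf} (hF : F ∈ L) (x : ℝ) :
    HasDerivAt (F : ℝ → ℝ) (deriv (F : ℝ → ℝ) x) x :=
  ((h.an F hF x (mem_univ x)).differentiableAt).hasDerivAt

theorem Good.dcont {L : Subgroup Lf} (h : Good L) {F : Lf} (hF : F ∈ L) :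
    Continuous (deriv (F : ℝ → ℝ)) := by
  have := (h.an F hF).deriv.continuousOn
  exact continuousOn_univ.1 this

theorem dper (F : Lf) (x : ℝ) : deriv (F : ℝ → ℝ) (x + 1) = deriv (F : ℝ → ℝ) x := by
  rw [← deriv_comp_add_const]
  have : (fun y => F (y + 1)) = fun y => F y + 1 := funext (ladd1 F)
  rw [this, deriv_add_const]

theorem Good.dmul {L : Subgroup Lf} (h : Good L) {F G : Lf} (hF : F ∈ L) (hG : G ∈ L) (x : ℝ) :
    deriv ((F * G : Lf) : ℝ → ℝ) x = deriv (F : ℝ → ℝ) (G x) * deriv (G : ℝ → ℝ) x :=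
  ((h.diff hF (G x)).comp x (h.diff hG x)).deriv

/-- difference of two elements: analytic dichotomy on the left side of a point -/
theorem Good.sub_an {L : Subgroup Lf} (h : Good L) {F G : Lf} (hF : F ∈ L) (hG : G ∈ L) :
    AnalyticOnNhd ℝ (fun x => F x - G x) univ :=
  (h.an F hF).sub (h.an G hG)

/-- If two elements agree frequently near a point (punctured), they are equal. -/
theorem Good.eq_of_freq {L : Subgroup Lf} (h : Good L) {F G : Lf} (hF : F ∈ L) (hG : G ∈ L)
    (a : ℝ) (hfr : ∃ᶠ x in 𝓝[≠] a, F x = G x) : F = G := by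
  have := (h.an F hF).eq_of_frequently_eq (h.an G hG) hfr
  exact lext fun x => congrFun this x

theorem Good.ev_ne {L : Subgroup Lf} (h : Good L) {F G : Lf} (hF : F ∈ L) (hG : G ∈ L)
    (hne : F ≠ G) (a : ℝ) : ∀ᶠ x in 𝓝[≠] a, F x ≠ G x := by
  by_contra hc
  exact hne (h.eq_of_freq hF hG a ((Filter.not_eventually.1 hc).mono fun x hx => not_not.1 hx))

/-- A continuous function which is eventually nonzero on the left of `a` has eventually
constant sign there. -/
theorem ev_sign {f : ℝ → ℝ} (hf : Continuous f) {a : ℝ} (h : ∀ᶠ x in 𝓝[<] a, f x ≠ 0) :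
    (∀ᶠ x in 𝓝[<] a, 0 < f x) ∨ (∀ᶠ x in 𝓝[<] a, f x < 0) := by
  obtain ⟨b, hb, hbs⟩ := (mem_nhdsLT_iff_exists_Ioo_subset).1 h
  have hb' : b < a := hb
  have key : ∀ x ∈ Ioo b a, ∀ y ∈ Ioo b a, 0 < f x → 0 < f y := by
    intro x hx y hy hfx
    by_contra hfy
    have h0 : (0 : ℝ) ∈ f '' (uIcc y x) :=
      intermediate_value_uIcc hf.continuousOn
        (by rw [uIcc_of_le (by linarith)]; exact ⟨by linarith, hfx.le⟩)
    obtain ⟨z, hz, hz0⟩ := h0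
    have : z ∈ Ioo b a := by
      have := ordConnected_Ioo.uIcc_subset hy hx hz
      exact this
    exact hbs this hz0
  have hI : ∀ᶠ x in 𝓝[<] a, x ∈ Ioo b a := Ioo_mem_nhdsLT hb'
  have hm : (b + a) / 2 ∈ Ioo b a := ⟨by linarith, by linarith⟩
  by_cases hc : 0 < f ((b + a) / 2)
  · left
    filter_upwards [hI] with x hx using key _ hm _ hx hc
  · right
    filter_upwards [hI] with x hx
    by_contra hx'
    have h1 : 0 < f x := lt_of_le_of_ne (not_lt.1 hx') (Ne.symm (hbs hx))
    exact hc (key _ hx _ hm h1)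

end RotImg

namespace RotImg

theorem cyc {G : Type*} [Group G] [LinearOrder G] [MulLeftMono G] [MulRightMono G]
    (H : ∀ f : G, 1 < f → ∃ N : ℕ, ∀ h : G, 1 < h → f ≤ h ^ N) (hnt : ∃ h : G, h ≠ 1) :
    ∃ f0 : G, f0 ≠ 1 ∧ ∀ h : G, ∃ j : ℤ, h = f0 ^ j := by
  have hpos : ∃ f : G, 1 < f := by
    obtain ⟨h, hh⟩ := hnt
    rcases lt_or_gt_of_ne hh with h1 | h1
    · exact ⟨h⁻¹, one_lt_inv'.2 h1⟩
    · exact ⟨h, h1⟩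
  obtain ⟨f, hf⟩ := hpos
  have hmin : ∃ f0 : G, 1 < f0 ∧ ∀ y, 1 < y → f0 ≤ y := by
    by_contra hc
    push Not at hc
    have half : ∀ e : G, 1 < e → ∃ h : G, 1 < h ∧ h ^ 2 ≤ e := by
      intro e he
      obtain ⟨y, hy1, hye⟩ := hc e he
      by_cases h2 : y ^ 2 ≤ e
      · exact ⟨y, hy1, h2⟩
      · refine ⟨e * y⁻¹, ?_, ?_⟩
        · rwa [lt_mul_inv_iff_mul_lt, one_mul]
        · rw [not_le] at h2
          have h3 : e * y⁻¹ ≤ y := by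
            rw [mul_inv_le_iff_le_mul, ← pow_two]; exact h2.le
          calc (e * y⁻¹) ^ 2 = e * (y⁻¹ * (e * y⁻¹)) := by rw [pow_two]; group
            _ ≤ e * (y⁻¹ * y) := by gcongr
            _ = e := by group
    have pw : ∀ k : ℕ, ∃ h : G, 1 < h ∧ h ^ (2 ^ k) ≤ f := by
      intro k
      induction k with
      | zero => exact ⟨f, hf, by simp⟩
      | succ k ih =>
        obtain ⟨h, h1, h2⟩ := ih
        obtain ⟨h', h1', h2'⟩ := half h h1
        refine ⟨h', h1', ?_⟩
        rw [pow_succ', pow_mul]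
        exact (pow_le_pow_left' h2' _).trans h2
    obtain ⟨N, hN⟩ := H f hf
    obtain ⟨h, h1, h2⟩ := pw N
    have h3 := hN h h1
    have h4 : h ^ N < h ^ (2 ^ N) := pow_lt_pow_right' h1 Nat.lt_two_pow_self
    exact absurd (h4.trans_le h2) (not_lt.2 h3)
  obtain ⟨f0, h0, hm⟩ := hmin
  refine ⟨f0, h0.ne', ?_⟩
  have nn : ∀ h : G, 1 < h → ∃ j : ℕ, h = f0 ^ j := by
    intro h hh
    have ex : ∃ n : ℕ, h < f0 ^ n := by
      obtain ⟨N, hN⟩ := H h hh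
      refine ⟨N + 1, (hN f0 h0).trans_lt ?_⟩
      exact pow_lt_pow_right' h0 (Nat.lt_succ_self N)
    have hsp := Nat.find_spec ex
    obtain ⟨n, hn⟩ : ∃ n, Nat.find ex = n + 1 := by
      refine Nat.exists_eq_succ_of_ne_zero fun h00 => ?_
      rw [h00, pow_zero] at hsp
      exact absurd hh (not_lt.2 hsp.le)
    have hle : f0 ^ n ≤ h := not_lt.1 (Nat.find_min ex (by omega))
    rw [hn] at hsp
    refine ⟨n, ?_⟩
    by_contra hne
    have h5 : f0 ^ n < h := lt_of_le_of_ne hle (Ne.symm hne)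
    have h6 : 1 < (f0 ^ n)⁻¹ * h := by rwa [lt_inv_mul_iff_mul_lt, mul_one]
    have h7 := hm _ h6
    rw [le_inv_mul_iff_mul_le, ← pow_succ] at h7
    exact absurd hsp (not_lt.2 h7)
  intro h
  rcases lt_trichotomy h 1 with h1 | h1 | h1
  · obtain ⟨j, hj⟩ := nn h⁻¹ (one_lt_inv'.2 h1)
    exact ⟨-j, by rw [zpow_neg, zpow_natCast, ← hj, inv_inv]⟩
  · exact ⟨0, by simp [h1]⟩
  · obtain ⟨j, hj⟩ := nn h h1
    exact ⟨j, by rw [zpow_natCast, ← hj]⟩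

end RotImg

namespace RotImg

/-- The distortion and comparison lemma at a left accumulation point of an invariant
nowhere dense set. -/
theorem lemmaE {L : Subgroup Lf} (hL : Good L) {X : Set ℝ} (hXc : IsClosed X) (hXi : ∀ F ∈ L, ∀ x ∈ X, F x ∈ X)
    (hXe : interior X = ∅) {a : ℝ} (hacc : ∀ x < a, ∃ y ∈ X, x < y ∧ y < a)
    {f : Lf} (hf : f ∈ L) (hfa : f a = a) (hfp : ∀ᶠ x in 𝓝[<] a, x < f x) :
    ∃ N : ℕ, ∀ h ∈ L, h a = a → (∀ᶠ x in 𝓝[<] a, x < h x) →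
      ∀ᶠ x in 𝓝[<] a, f x ≤ (h ^ N : Lf) x := by
  obtain ⟨b, hb, hbs⟩ := (mem_nhdsLT_iff_exists_Ioo_subset).1 hfp
  have hb' : b < a := hb
  obtain ⟨x0, hx0b, hx0a⟩ := exists_between hb'
  have hfx : ∀ x, x0 ≤ x → x < a → x < f x := fun x h1 h2 => hbs ⟨by linarith, h2⟩
  have hflt : ∀ x, x < a → f x < a := fun x hx => by rw [← hfa]; exact (llt f).2 hx
  -- Lipschitz bound for the logarithm of the derivative
  obtain ⟨C, hC0, hC⟩ : ∃ C : ℝ, 0 ≤ C ∧ ∀ x ∈ Icc x0 a, ∀ y ∈ Icc x0 a,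
      |Real.log (deriv f x) - Real.log (deriv f y)| ≤ C * |x - y| := by
    have han : AnalyticOnNhd ℝ (fun x => Real.log (deriv f x)) univ := by
      intro x hx
      exact ((hL.an f hf).deriv x hx).log (hL.dpos f hf x)
    have hdc : ContinuousOn (fun x => ‖deriv (fun x => Real.log (deriv f x)) x‖) (Icc x0 a) :=
      (han.deriv.continuousOn.mono (subset_univ _)).norm
    obtain ⟨C, hC⟩ := isCompact_Icc.exists_bound_of_continuousOn hdc
    refine ⟨max C 0, le_max_right _ _, ?_⟩
    intro x hx y hy
    have := (convex_Icc x0 a).norm_image_sub_le_of_norm_deriv_le (𝕜 := ℝ)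
      (f := fun x => Real.log (deriv f x)) (C := max C 0)
      (fun z _ => (han z (mem_univ z)).differentiableAt)
      (fun z hz => by
        have := hC z hz
        rw [norm_norm] at this
        exact this.trans (le_max_left _ _)) hy hx
    simpa [Real.norm_eq_abs] using this
  obtain ⟨κ, hκ0, hκ1, hκ⟩ : ∃ κ : ℝ, 0 < κ ∧ κ ≤ 1 ∧ ∀ x ∈ Icc x0 a, κ ≤ deriv f x := by
    obtain ⟨z, hz, hzm⟩ := isCompact_Icc.exists_isMinOn (nonempty_Icc.2 hx0a.le)
      ((hL.dcont hf).continuousOn (s := Icc x0 a))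
    exact ⟨min 1 (deriv f z), lt_min one_pos (hL.dpos f hf z), min_le_left _ _,
      fun x hx => (min_le_right _ _).trans (hzm hx)⟩
  -- mean value
  have mvt : ∀ x y, x < y → ∃ ξ ∈ Ioo x y, f y - f x = deriv f ξ * (y - x) := by
    intro x y hxy
    obtain ⟨ξ, h1, h2⟩ := exists_hasDerivAt_eq_slope f (deriv f) hxy (lcont f).continuousOn
      (fun z _ => hL.diff hf z)
    refine ⟨ξ, h1, ?_⟩
    rw [h2]; field_simp [sub_ne_zero.2 hxy.ne']
  -- the gap
  obtain ⟨u, v, huX, hu0, hua, huv, hvf, hgap⟩ : ∃ u v, u ∈ X ∧ x0 < u ∧ u < a ∧ u < v ∧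
      v ≤ f u ∧ ∀ x ∈ X, u < x → v ≤ x := by
    obtain ⟨y, hyX, hy0, hya⟩ := hacc x0 hx0a
    have hyf := hfx y hy0.le hya
    obtain ⟨z, hz, hzX⟩ : ∃ z ∈ Ioo y (f y), z ∉ X := by
      by_contra hc
      push Not at hc
      have h1 : Ioo y (f y) ⊆ interior X := interior_maximal hc isOpen_Ioo
      rw [hXe] at h1
      exact (nonempty_Ioo.2 hyf).not_subset_empty h1
    obtain ⟨u, hu⟩ := (isCompact_Icc (a := y) (b := z)).inter_right hXc |>.exists_isGreatest
      ⟨y, ⟨le_rfl, hz.1.le⟩, hyX⟩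
    have huz : u < z := lt_of_le_of_ne hu.1.1.2 (fun h => hzX (h ▸ hu.1.2))
    refine ⟨u, z, hu.1.2, lt_of_lt_of_le hy0 hu.1.1.1, ?_, huz, ?_, ?_⟩
    · exact huz.trans (hz.2.trans (hflt y hya))
    · exact hz.2.le.trans ((lle f).2 hu.1.1.1)
    · intro x hx hux
      by_contra hc
      exact absurd (hu.2 ⟨⟨hu.1.1.1.trans hux.le, (not_le.1 hc).le⟩, hx⟩) (not_le.2 hux)
  set U : ℕ → ℝ := fun k => (f ^ k : Lf) u with hU
  set V : ℕ → ℝ := fun k => (f ^ k : Lf) v with hV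
  have hUs : ∀ k, U (k + 1) = f (U k) := fun k => lpow_succ f k u
  have hVs : ∀ k, V (k + 1) = f (V k) := fun k => lpow_succ f k v
  have hU0 : U 0 = u := rfl
  have hV0 : V 0 = v := rfl
  have hUb : ∀ k, x0 < U k ∧ U k < a := by
    intro k
    induction k with
    | zero => exact ⟨hu0, hua⟩
    | succ k ih =>
      rw [hUs]
      exact ⟨ih.1.trans (hfx _ ih.1.le ih.2), hflt _ ih.2⟩
  have hUV : ∀ k, U k < V k := fun k => (llt _).2 huv
  have hVU : ∀ k, V k ≤ U (k + 1) := by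
    intro k
    have : U (k + 1) = (f ^ k : Lf) (f u) := lpow_succ' f k u
    rw [this]; exact (lle _).2 hvf
  have hUU : ∀ k, U k < U (k + 1) := fun k => (hUV k).trans_le (hVU k)
  set c0 := (v - u) / (f u - u) with hc0
  have hfu : 0 < f u - u := by linarith
  have hc0p : 0 < c0 := div_pos (by linarith) hfu
  have key : ∀ k, c0 * Real.exp (-(C * (U k - u))) * (U (k + 1) - U k) ≤ V k - U k := by
    intro k
    induction k with
    | zero =>
      have h1 : U (0 + 1) = f u := hUs 0
      rw [h1, hU0, hV0, hc0]
      simp only [sub_self, mul_zero, neg_zero, Real.exp_zero, mul_one]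
      rw [div_mul_cancel₀ _ hfu.ne']
    | succ k ih =>
      obtain ⟨ξ, hξ, hξe⟩ := mvt _ _ (hUV k)
      obtain ⟨η, hη, hηe⟩ := mvt _ _ (hUU k)
      rw [← hUs, ← hVs] at hξe
      rw [← hUs, ← hUs] at hηe
      rw [hξe, hηe]
      have h1 := (hUb k).1
      have h2 := (hUb (k + 1)).2
      have h3 := hVU k
      have hd := hC η ⟨by linarith [hη.1], by linarith [hη.2]⟩ ξ
        ⟨by linarith [hξ.1], by linarith [hξ.2]⟩
      have hab : |η - ξ| ≤ U (k + 1) - U k := by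
        rw [abs_le]; constructor <;> linarith [hη.1, hη.2, hξ.1, hξ.2]
      have hd2 : Real.log (deriv f η) - Real.log (deriv f ξ) ≤ C * (U (k + 1) - U k) :=
        (le_abs_self _).trans (hd.trans (mul_le_mul_of_nonneg_left hab hC0))
      have hpη := hL.dpos f hf η
      have hpξ := hL.dpos f hf ξ
      have hd3 : Real.exp (-(C * (U (k + 1) - U k))) * deriv f η ≤ deriv f ξ := by
        rw [← Real.exp_log hpη, ← Real.exp_log hpξ, ← Real.exp_add]
        exact Real.exp_le_exp.2 (by linarith)
      have hsplit : Real.exp (-(C * (U (k + 1) - u))) =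
          Real.exp (-(C * (U k - u))) * Real.exp (-(C * (U (k + 1) - U k))) := by
        rw [← Real.exp_add]; congr 1; ring
      calc c0 * Real.exp (-(C * (U (k + 1) - u))) * (deriv f η * (U (k + 1) - U k))
          = (Real.exp (-(C * (U (k + 1) - U k))) * deriv f η) *
            (c0 * Real.exp (-(C * (U k - u))) * (U (k + 1) - U k)) := by rw [hsplit]; ring
        _ ≤ deriv f ξ * (V k - U k) := by
            apply mul_le_mul hd3 ih _ hpξ.le
            have := hUU k
            have : 0 < U (k + 1) - U k := by linarith
            positivity
  set c1 := c0 * Real.exp (-(C * (a - u))) with hc1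
  have hc1p : 0 < c1 := by positivity
  have key2 : ∀ k, c1 * (f (U k) - U k) ≤ V k - U k := by
    intro k
    refine le_trans ?_ (key k)
    rw [← hUs]
    have := hUU k
    apply mul_le_mul_of_nonneg_right _ (by linarith)
    apply mul_le_mul_of_nonneg_left _ hc0p.le
    apply Real.exp_le_exp.2
    have := (hUb k).2
    nlinarith
  have hlim : ∀ b < a, ∃ k0, ∀ k ≥ k0, b < U k := by
    have hmono : Monotone U := monotone_nat_of_le_succ fun k => (hUU k).le
    have hbdd : BddAbove (range U) := ⟨a, by rintro _ ⟨k, rfl⟩; exact (hUb k).2.le⟩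
    have ht := tendsto_atTop_ciSup hmono hbdd
    set ℓ := ⨆ i, U i with hℓ
    have h1 : ℓ ≤ a := ciSup_le fun k => (hUb k).2.le
    have h2 : u ≤ ℓ := le_ciSup hbdd 0
    have h3 : f ℓ = ℓ := by
      have t1 : Tendsto (fun k => U (k + 1)) atTop (𝓝 (f ℓ)) := by
        simp only [hUs]
        exact ((lcont f).tendsto ℓ).comp ht
      exact tendsto_nhds_unique t1 ((tendsto_add_atTop_iff_nat 1).2 ht)
    have h4 : ℓ = a := by
      by_contra hne
      have := hfx ℓ (hu0.le.trans h2) (lt_of_le_of_ne h1 hne)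
      linarith
    intro b hb
    rw [h4] at ht
    exact eventually_atTop.1 (ht.eventually (lt_mem_nhds hb))
  -- choice of N
  set c := c1 / 2 with hc
  have hcp : 0 < c := by positivity
  obtain ⟨N, hN⟩ := exists_nat_ge (1 / (c * κ))
  refine ⟨N, ?_⟩
  intro h hh hha hhp
  have hhlt : ∀ x, x < a → h x < a := fun x hx => by rw [← hha]; exact (llt h).2 hx
  have hD : ∀ᶠ x in 𝓝[<] a, 0 < (h x - x) - c * (f x - x) := by
    have han : AnalyticOnNhd ℝ (fun x => (h x - x) - c * (f x - x)) univ := by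
      intro x hx
      have h1 := hL.an h hh x hx
      have h2 := hL.an f hf x hx
      exact (h1.sub analyticAt_id).sub (analyticAt_const.mul (h2.sub analyticAt_id))
    have hfreq : ∃ᶠ x in 𝓝[<] a, 0 < (h x - x) - c * (f x - x) := by
      rw [frequently_iff]
      intro S hS
      obtain ⟨b1, hb1, hbs1⟩ := (mem_nhdsLT_iff_exists_Ioo_subset).1 (inter_mem hS hhp)
      obtain ⟨k, hk⟩ := hlim b1 hb1
      have hkk := hk k le_rfl
      have hmem := hbs1 ⟨hkk, (hUb k).2⟩
      refine ⟨U k, hmem.1, ?_⟩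
      have hlt : U k < h (U k) := hmem.2
      have hUX : U k ∈ X := hXi _ (L.pow_mem hf k) u huX
      have hw : ((f ^ k : Lf)⁻¹ : Lf) (h (U k)) ∈ X :=
        hXi _ (L.inv_mem (L.pow_mem hf k)) _ (hXi h hh _ hUX)
      have hge : V k ≤ h (U k) := by
        have h1 : u < ((f ^ k : Lf)⁻¹ : Lf) (h (U k)) := by
          rw [← llt (f ^ k), linv']; exact hlt
        have h2 := hgap _ hw h1
        rw [← lle (f ^ k), linv'] at h2
        exact h2
      have h3 := key2 k
      have h4 : 0 < f (U k) - U k := by have := hUU k; rw [hUs] at this; linarith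
      have h5 : c * (f (U k) - U k) < c1 * (f (U k) - U k) :=
        mul_lt_mul_of_pos_right (by rw [hc]; linarith) h4
      linarith
    have hcont : Continuous (fun x => (h x - x) - c * (f x - x)) :=
      ((lcont h).sub continuous_id).sub (continuous_const.mul ((lcont f).sub continuous_id))
    rcases (han a (mem_univ a)).eventually_eq_zero_or_eventually_ne_zero with h0 | h0
    · exfalso
      have h0' : ∀ᶠ x in 𝓝[<] a, (h x - x) - c * (f x - x) = 0 :=
        h0.filter_mono nhdsWithin_le_nhds
      obtain ⟨x, hx1, hx2⟩ := (hfreq.and_eventually h0').exists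
      exact hx1.ne' hx2
    · have h0' : ∀ᶠ x in 𝓝[<] a, (h x - x) - c * (f x - x) ≠ 0 :=
        h0.filter_mono (nhdsWithin_mono a fun x hx => ne_of_lt hx)
      rcases ev_sign hcont h0' with h1 | h1
      · exact h1
      · exfalso
        obtain ⟨x, hx1, hx2⟩ := (hfreq.and_eventually h1).exists
        exact lt_asymm hx1 hx2
  obtain ⟨b1, hb1, hbs1⟩ := (mem_nhdsLT_iff_exists_Ioo_subset).1 (inter_mem hD hhp)
  have hb1' : b1 < a := hb1
  have hI : ∀ᶠ x in 𝓝[<] a, x ∈ Ioo (max b1 x0) a := Ioo_mem_nhdsLT (max_lt hb1' hx0a)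
  filter_upwards [hI] with x hx
  have hxb : b1 < x := lt_of_le_of_lt (le_max_left _ _) hx.1
  have hx0 : x0 < x := lt_of_le_of_lt (le_max_right _ _) hx.1
  have hxa := hx.2
  have hd : 0 < f x - x := by linarith [hfx x hx0.le hxa]
  have hcκ : 0 < c * κ := mul_pos hcp hκ0
  have claim : ∀ j : ℕ, (h ^ j : Lf) x < a ∧
      min (f x) (x + j * (c * κ) * (f x - x)) ≤ (h ^ j : Lf) x := by
    intro j
    induction j with
    | zero => exact ⟨hxa, by simp [lone]⟩
    | succ j ih =>
      obtain ⟨ih1, ih2⟩ := ih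
      rw [lpow_succ]
      set y := (h ^ j : Lf) x with hy
      refine ⟨hhlt _ ih1, ?_⟩
      have hxy : x ≤ y := by
        refine le_trans (le_min (by linarith) ?_) ih2
        have : 0 ≤ (j : ℝ) * (c * κ) * (f x - x) := by positivity
        linarith
      have hy1 := hbs1 ⟨hxb.trans_le hxy, ih1⟩
      have hy2 : y < h y := hy1.2
      have hy3 : 0 < (h y - y) - c * (f y - y) := hy1.1
      rcases le_or_gt (f x) y with h1 | h1
      · exact (min_le_left _ _).trans (h1.trans hy2.le)
      · refine (min_le_right _ _).trans ?_
        have h2 : x + j * (c * κ) * (f x - x) ≤ y := by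
          rcases min_le_iff.1 ih2 with h3 | h3
          · linarith
          · exact h3
        have h4 : κ * (f x - x) ≤ f y - y := by
          have h5 : f x + κ * (y - x) ≤ f y := by
            rcases hxy.eq_or_lt with h6 | h6
            · rw [← h6]; simp
            · obtain ⟨ξ, hξ, hξe⟩ := mvt _ _ h6
              have := hκ ξ ⟨by linarith [hξ.1], by linarith [hξ.2]⟩
              nlinarith
          nlinarith
        have h7 : c * (κ * (f x - x)) ≤ c * (f y - y) := mul_le_mul_of_nonneg_left h4 hcp.le
        push_cast
        nlinarith
  have hfin := (claim N).2
  rw [min_eq_left] at hfin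
  · exact hfin
  · have h1 : 1 ≤ (N : ℝ) * (c * κ) := by
      rwa [div_le_iff₀ hcκ] at hN
    have h2 := mul_le_mul_of_nonneg_right h1 hd.le
    linarith

end RotImg

namespace RotImg

theorem tendsto_left (z : Lf) {a : ℝ} (hz : z a = a) :
    Tendsto (z : ℝ → ℝ) (𝓝[<] a) (𝓝[<] a) := by
  refine tendsto_nhdsWithin_iff.2 ⟨?_, ?_⟩
  · have := (lcont z).tendsto a
    rw [hz] at this
    exact this.mono_left nhdsWithin_le_nhds
  · filter_upwards [self_mem_nhdsWithin] with x hx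
    show z x < a
    rw [← hz]; exact (llt z).2 hx

theorem Good.left_ne {L : Subgroup Lf} (h : Good L) {F G : Lf} (hF : F ∈ L) (hG : G ∈ L)
    (hne : F ≠ G) (a : ℝ) :
    (∀ᶠ x in 𝓝[<] a, F x < G x) ∨ (∀ᶠ x in 𝓝[<] a, G x < F x) := by
  have h1 : ∀ᶠ x in 𝓝[<] a, G x - F x ≠ 0 := by
    have := (h.ev_ne hF hG hne a).filter_mono
      (nhdsWithin_mono a (fun x (hx : x ∈ Iio a) => ne_of_lt hx))
    filter_upwards [this] with x hx h0
    exact hx (by linarith)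
  rcases ev_sign ((lcont G).sub (lcont F)) h1 with h2 | h2
  · left; filter_upwards [h2] with x hx; simp only [Pi.sub_apply] at hx; linarith
  · right; filter_upwards [h2] with x hx; simp only [Pi.sub_apply] at hx; linarith

/-- stabilizer of a point -/
def stab (L : Subgroup Lf) (a : ℝ) : Subgroup Lf where
  carrier := {F | F ∈ L ∧ F a = a}
  mul_mem' := fun {F G} hF hG => ⟨L.mul_mem hF.1 hG.1, by rw [lmul, hG.2, hF.2]⟩
  one_mem' := ⟨L.one_mem, rfl⟩
  inv_mem' := fun {F} hF => ⟨L.inv_mem hF.1, by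
    have := linv F a
    rwa [hF.2] at this⟩

/-- The stabilizer, as a type without the pointwise order. -/
def StabT (L : Subgroup Lf) (a : ℝ) : Type := stab L a

instance instGroupStabT (L : Subgroup Lf) (a : ℝ) : Group (StabT L a) :=
  inferInstanceAs (Group (stab L a))

theorem stab_cyclic {L : Subgroup Lf} (hL : Good L) {X : Set ℝ} (hXc : IsClosed X)
    (hXi : ∀ F ∈ L, ∀ x ∈ X, F x ∈ X)
    (hXe : interior X = ∅) {a : ℝ} (hacc : ∀ x < a, ∃ y ∈ X, x < y ∧ y < a)
    (hnt : ∃ F ∈ L, F a = a ∧ F ≠ 1) :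
    ∃ f0 ∈ L, f0 ≠ 1 ∧ ∀ F ∈ L, F a = a → ∃ j : ℤ, F = f0 ^ j := by
  let A := StabT L a
  let ord : LinearOrder A :=
    { le := fun F G => ∀ᶠ x in 𝓝[<] a, F.1 x ≤ G.1 x
      le_refl := fun F => Eventually.of_forall fun x => le_rfl
      le_trans := fun F G H h1 h2 => by
        filter_upwards [h1, h2] with x hx hy using hx.trans hy
      le_antisymm := fun F G h1 h2 => by
        by_contra hne
        have hne' : F.1 ≠ G.1 := fun h => hne (Subtype.ext h)
        rcases hL.left_ne F.2.1 G.2.1 hne' a with h | h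
        · obtain ⟨x, hx⟩ := (h.and h2).exists
          exact absurd hx.1 (not_lt.2 hx.2)
        · obtain ⟨x, hx⟩ := (h.and h1).exists
          exact absurd hx.1 (not_lt.2 hx.2)
      le_total := fun F G => by
        by_cases hne : F.1 = G.1
        · left; rw [hne]
          exact Eventually.of_forall fun x => le_rfl
        · rcases hL.left_ne F.2.1 G.2.1 hne a with h | h
          · left; exact h.mono fun x hx => hx.le
          · right; exact h.mono fun x hx => hx.le
      toDecidableLE := Classical.decRel _ }
  have ledef : ∀ F G : A, F ≤ G ↔ ∀ᶠ x in 𝓝[<] a, F.1 x ≤ G.1 x := fun F G => Iff.rfl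
  have : MulLeftMono A := ⟨fun F G H h => by
    rw [ledef] at h ⊢
    filter_upwards [h] with x hx
    exact (lle F.1).2 hx⟩
  have : MulRightMono A := ⟨fun F G H h => by
    rw [ledef] at h
    show ∀ᶠ x in 𝓝[<] a, (G * F : A).1 x ≤ (H * F : A).1 x
    exact (tendsto_left F.1 F.2.2).eventually h⟩
  have ltdef : ∀ F : A, 1 < F → ∀ᶠ x in 𝓝[<] a, x < F.1 x := by
    intro F hF
    have hne : (1 : Lf) ≠ F.1 := fun h => hF.ne (Subtype.ext h)
    rcases hL.left_ne L.one_mem F.2.1 hne a with h | h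
    · exact h
    · exfalso
      exact absurd (show F ≤ 1 from h.mono fun x hx => hx.le) (not_le.2 hF)
  obtain ⟨f0, h0, hj⟩ := cyc (G := A) (by
    intro f hf
    obtain ⟨N, hN⟩ := lemmaE hL hXc hXi hXe hacc f.2.1 f.2.2 (ltdef f hf)
    refine ⟨N, fun h hh => ?_⟩
    exact hN h.1 h.2.1 h.2.2 (ltdef h hh)) (by
    obtain ⟨F, h1, h2, h3⟩ := hnt
    exact ⟨⟨F, h1, h2⟩, fun h => h3 (congrArg Subtype.val h)⟩)
  refine ⟨f0.1, f0.2.1, fun h => h0 (Subtype.ext h), ?_⟩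
  intro F hF hFa
  obtain ⟨j, hj⟩ := hj ⟨F, hF, hFa⟩
  refine ⟨j, ?_⟩
  have h1 := congrArg Subtype.val hj
  have h2 : ((f0 ^ j : A)).1 = f0.1 ^ j := Subgroup.coe_zpow (stab L a) f0 j
  rw [← h2]; exact h1

theorem pow_ge (G : Lf) {x : ℝ} (h : x ≤ G x) (n : ℕ) : G x ≤ (G ^ (n + 1) : Lf) x := by
  induction n with
  | zero => simp
  | succ n ih =>
    rw [lpow_succ]
    exact (lle G).2 (h.trans ih)

theorem pow_le (G : Lf) {x : ℝ} (h : G x ≤ x) (n : ℕ) : (G ^ (n + 1) : Lf) x ≤ G x := by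
  induction n with
  | zero => simp
  | succ n ih =>
    rw [lpow_succ]
    exact (lle G).2 (ih.trans h)

theorem zpow_far (G : Lf) {x : ℝ} (h : G x ≠ x) :
    ∃ δ > 0, ∀ j : ℤ, j ≠ 0 → δ ≤ |(G ^ j : Lf) x - x| := by
  have key : ∀ H : Lf, H x ≠ x → ∀ n : ℕ, |H x - x| ≤ |(H ^ (n + 1) : Lf) x - x| := by
    intro H hH n
    rcases lt_or_gt_of_ne hH with h1 | h1
    · have := pow_le H h1.le n
      rw [abs_of_neg (by linarith), abs_of_neg (by linarith)]; linarith
    · have := pow_ge H h1.le n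
      rw [abs_of_pos (by linarith), abs_of_pos (by linarith)]; linarith
  have h' : (G⁻¹ : Lf) x ≠ x := fun h2 => h (by
    conv_lhs => rw [← h2]
    exact linv' G x)
  refine ⟨min |G x - x| |(G⁻¹ : Lf) x - x|,
    lt_min (abs_pos.2 (sub_ne_zero.2 h)) (abs_pos.2 (sub_ne_zero.2 h')), ?_⟩
  intro j hj
  rcases lt_or_gt_of_ne hj with h1 | h1
  · obtain ⟨n, hn⟩ : ∃ n : ℕ, j = -((n + 1 : ℕ) : ℤ) := ⟨(-j - 1).toNat, by omega⟩
    rw [hn, zpow_neg, zpow_natCast, ← inv_pow]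
    exact (min_le_right _ _).trans (key _ h' n)
  · obtain ⟨n, hn⟩ : ∃ n : ℕ, j = ((n + 1 : ℕ) : ℤ) := ⟨(j - 1).toNat, by omega⟩
    rw [hn, zpow_natCast]
    exact (min_le_left _ _).trans (key _ h n)

/-- There is no exceptional minimal set under local nondiscreteness. -/
theorem exc_false {L : Subgroup Lf} (hL : Good L) {X : Set ℝ} (hXc : IsClosed X)
    (hXi : ∀ F ∈ L, ∀ x ∈ X, F x ∈ X) (hXe : interior X = ∅) (hXn : X.Nonempty)
    (hXp : ∀ x ∈ X, AccPt x (𝓟 X)) {a0 b0 : ℝ} (hab : a0 < b0) (F : ℕ → Lf)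
    (hF : ∀ n, F n ∈ L ∧ F n ≠ 1)
    (hnd : ∀ ε > 0, ∃ N, ∀ n ≥ N, ∀ x ∈ Ioo a0 b0, |F n x - x| < ε) : False := by
  obtain ⟨x, hx, hxX⟩ : ∃ z ∈ Ioo a0 b0, z ∉ X := by
    by_contra hc
    push Not at hc
    have h1 : Ioo a0 b0 ⊆ interior X := interior_maximal hc isOpen_Ioo
    rw [hXe] at h1
    exact (nonempty_Ioo.2 hab).not_subset_empty h1
  obtain ⟨y, hyX, hyx⟩ : ∃ y ∈ X, y < x := by
    obtain ⟨y, hy⟩ := hXn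
    obtain ⟨n, hn⟩ := exists_int_gt (y - x)
    refine ⟨trans (-n) y, hXi _ (hL.tr _) _ hy, ?_⟩
    rw [trans_apply]; push_cast; linarith
  obtain ⟨a, ha⟩ := (isCompact_Icc (a := y) (b := x)).inter_right hXc |>.exists_isGreatest
      ⟨y, ⟨le_rfl, hyx.le⟩, hyX⟩
  have haX : a ∈ X := ha.1.2
  have hax : a < x := lt_of_le_of_ne ha.1.1.2 (fun h => hxX (h ▸ haX))
  have hgap : ∀ z ∈ X, z ≤ x → z ≤ a := by
    intro z hz hzx
    by_contra hc
    rw [not_le] at hc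
    exact absurd (ha.2 ⟨⟨ha.1.1.1.trans hc.le, hzx⟩, hz⟩) (not_le.2 hc)
  obtain ⟨x', hx', hx's⟩ : ∃ x' > x, ∀ z, x ≤ z → z < x' → z ∉ X := by
    have : Xᶜ ∈ 𝓝 x := hXc.isOpen_compl.mem_nhds hxX
    obtain ⟨ε, hε, hb⟩ := Metric.mem_nhds_iff.1 this
    refine ⟨x + ε, by linarith, fun z h1 h2 => hb ?_⟩
    rw [Metric.mem_ball, Real.dist_eq, abs_lt]
    constructor <;> linarith
  have hgap' : ∀ z ∈ X, z < x' → z ≤ a := by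
    intro z hz hzx
    rcases le_or_gt z x with h | h
    · exact hgap z hz h
    · exact absurd hz (hx's z h.le hzx)
  have hfix : ∃ N, ∀ n ≥ N, F n a = a := by
    obtain ⟨N, hN⟩ := hnd (min (x' - x) (x - a)) (lt_min (by linarith) (by linarith))
    refine ⟨N, fun n hn => ?_⟩
    have h1 := abs_lt.1 (hN n hn x hx)
    have h2 := min_le_left (x' - x) (x - a)
    have h3 := min_le_right (x' - x) (x - a)
    apply le_antisymm
    · refine hgap' _ (hXi _ (hF n).1 _ haX) ?_
      have := (llt (F n)).2 hax
      linarith [h1.2]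
    · have h4 : ((F n)⁻¹ : Lf) a ≤ a := by
        refine hgap _ (hXi _ (L.inv_mem (hF n).1) _ haX) ?_
        rw [← lle (F n), linv']
        linarith [h1.1]
      rw [← lle (F n), linv'] at h4
      exact h4
  have hacc : ∀ z < a, ∃ y ∈ X, z < y ∧ y < a := by
    intro z hz
    have h1 := accPt_iff_frequently.1 (hXp a haX)
    have h2 : ∀ᶠ y in 𝓝 a, y ∈ Ioo z x := Ioo_mem_nhds hz hax
    obtain ⟨y, ⟨hy1, hy2⟩, hy3⟩ := (h1.and_eventually h2).exists
    exact ⟨y, hy2, hy3.1, lt_of_le_of_ne (hgap y hy2 hy3.2.le) hy1⟩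
  obtain ⟨N, hN⟩ := hfix
  obtain ⟨f0, hf0, hf1, hf2⟩ := stab_cyclic hL hXc hXi hXe hacc
    ⟨F N, (hF N).1, hN N le_rfl, (hF N).2⟩
  obtain ⟨x1, hx1, hx2⟩ : ∃ x1 ∈ Ioo a0 b0, f0 x1 ≠ x1 := by
    have h1 := (hL.ev_ne hf0 L.one_mem hf1 x)
    have h2 : ∀ᶠ z in 𝓝[≠] x, z ∈ Ioo a0 b0 :=
      nhdsWithin_le_nhds (Ioo_mem_nhds hx.1 hx.2)
    obtain ⟨z, hz⟩ := (h2.and h1).exists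
    exact ⟨z, hz.1, hz.2⟩
  obtain ⟨δ, hδ, hfar⟩ := zpow_far f0 hx2
  obtain ⟨N', hN'⟩ := hnd δ hδ
  have h1 := hN' (max N N') (le_max_right _ _) x1 hx1
  obtain ⟨j, hj⟩ := hf2 _ (hF (max N N')).1 (hN _ (le_max_left _ _))
  have hj0 : j ≠ 0 := by
    rintro rfl
    rw [zpow_zero] at hj
    exact (hF _).2 hj
  have h2 := hfar j hj0
  rw [← hj] at h2
  linarith

end RotImg

namespace RotImg

/-- A set invariant under the group. -/
def Inv (L : Subgroup Lf) (X : Set ℝ) : Prop := ∀ F ∈ L, ∀ x ∈ X, F x ∈ X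

theorem exists_minimal {L : Subgroup Lf} (hL : Good L) :
    ∃ Λ : Set ℝ, IsClosed Λ ∧ Λ.Nonempty ∧ Inv L Λ ∧
      ∀ X ⊆ Λ, IsClosed X → X.Nonempty → Inv L X → X = Λ := by
  have hz : ∃ m, Minimal (· ∈ {X : Set ℝ | IsClosed X ∧ X.Nonempty ∧ Inv L X}) m := by
    apply zorn_superset
    intro c hc hch
    rcases c.eq_empty_or_nonempty with h0 | h0
    · exact ⟨univ, ⟨isClosed_univ, univ_nonempty, fun _ _ _ _ => mem_univ _⟩, by simp [h0]⟩
    · refine ⟨⋂₀ c, ⟨isClosed_sInter fun s hs => (hc hs).1, ?_, ?_⟩, fun s hs => sInter_subset_of_mem hs⟩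
      · have hne : ∀ s ∈ c, (s ∩ Icc (0 : ℝ) 1).Nonempty := by
          intro s hs
          obtain ⟨y, hy⟩ := (hc hs).2.1
          refine ⟨trans (-⌊y⌋) y, (hc hs).2.2 _ (hL.tr _) _ hy, ?_⟩
          rw [trans_apply]
          push_cast
          constructor
          · linarith [Int.floor_le y]
          · linarith [Int.lt_floor_add_one y]
        have := IsCompact.nonempty_sInter_of_directed_nonempty_isCompact_isClosed
          (S := (fun s => s ∩ Icc (0 : ℝ) 1) '' c) (hS := (h0.image _).to_subtype) ?_ ?_ ?_ ?_
        · obtain ⟨x, hx⟩ := this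
          refine ⟨x, fun s hs => (hx _ ⟨s, hs, rfl⟩).1⟩
        · rintro _ ⟨s, hs, rfl⟩ _ ⟨t, ht, rfl⟩
          rcases hch.total hs ht with h | h
          · exact ⟨_, ⟨s, hs, rfl⟩, subset_rfl, inter_subset_inter_left _ h⟩
          · exact ⟨_, ⟨t, ht, rfl⟩, inter_subset_inter_left _ h, subset_rfl⟩
        · rintro _ ⟨s, hs, rfl⟩; exact hne s hs
        · rintro _ ⟨s, hs, rfl⟩
          exact isCompact_Icc.inter_left (hc hs).1
        · rintro _ ⟨s, hs, rfl⟩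
          exact (hc hs).1.inter isClosed_Icc
      · intro F hF x hx s hs
        exact (hc hs).2.2 F hF x (hx s hs)
  obtain ⟨m, hm⟩ := hz
  refine ⟨m, hm.prop.1, hm.prop.2.1, hm.prop.2.2, ?_⟩
  intro X hX h1 h2 h3
  exact hX.antisymm (hm.2 (show X ∈ {X : Set ℝ | IsClosed X ∧ X.Nonempty ∧ Inv L X} from ⟨h1, h2, h3⟩) hX)

theorem inv_interior {L : Subgroup Lf} {X : Set ℝ} (hX : Inv L X) : Inv L (interior X) := by
  intro F hF x hx
  have ho : IsOpen ((F⁻¹ : Lf) ⁻¹' (interior X)) := isOpen_interior.preimage (lcont F⁻¹)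
  have hs : (F⁻¹ : Lf) ⁻¹' (interior X) ⊆ X := by
    intro y hy
    have := hX F hF _ (interior_subset hy)
    rwa [linv'] at this
  apply interior_maximal hs ho
  show (F⁻¹ : Lf) (F x) ∈ interior X
  rwa [linv]

theorem inv_derived {L : Subgroup Lf} {X : Set ℝ} (hX : Inv L X) :
    Inv L (X ∩ {x | AccPt x (𝓟 X)}) := by
  intro F hF x hx
  refine ⟨hX F hF x hx.1, ?_⟩
  have h1 : AccPt x (𝓟 X) := hx.2
  show AccPt (F x) (𝓟 X)
  rw [accPt_iff_frequently] at h1 ⊢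
  refine ((lcont F).tendsto x).frequently (h1.mono ?_)
  rintro y ⟨h2, h3⟩
  exact ⟨fun h => h2 ((lstrict F).injective h), hX F hF y h3⟩

/-- The minimal case is the only one. -/
theorem minimal_case {L : Subgroup Lf} (hL : Good L)
    (hfin : ∀ X : Set ℝ, X.Nonempty → Inv L X → ¬ (X ∩ Icc (0 : ℝ) 1).Finite)
    {a0 b0 : ℝ} (hab : a0 < b0) (F : ℕ → Lf)
    (hF : ∀ n, F n ∈ L ∧ F n ≠ 1)
    (hnd : ∀ ε > 0, ∃ N, ∀ n ≥ N, ∀ x ∈ Ioo a0 b0, |F n x - x| < ε) :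
    ∀ X : Set ℝ, IsClosed X → X.Nonempty → Inv L X → X = univ := by
  obtain ⟨Λ, hc, hn, hi, hm⟩ := exists_minimal hL
  by_cases hIntr : interior Λ = ∅
  · exfalso
    have hD : Λ ∩ {x | AccPt x (𝓟 Λ)} = Λ := by
      apply hm _ inter_subset_left
      · exact hc.inter (isClosed_derivedSet Λ)
      · obtain ⟨x, hx, hx2⟩ := (Set.not_finite.1 (hfin Λ hn hi) : (Λ ∩ Icc (0 : ℝ) 1).Infinite).exists_accPt_of_subset_isCompact
          isCompact_Icc inter_subset_right
        have h1 : AccPt x (𝓟 Λ) := hx2.mono (principal_mono.2 inter_subset_left)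
        refine ⟨x, ?_, h1⟩
        exact hc.closure_subset (mem_closure_iff_clusterPt.2 h1.clusterPt)
      · exact inv_derived hi
    exact exc_false hL hc hi hIntr hn (fun x hx => (hD.symm ▸ hx : x ∈ Λ ∩ {x | AccPt x (𝓟 Λ)}).2)
      hab F hF hnd
  · have hu : Λ = univ := by
      have hfr : Λ \ interior Λ = ∅ := by
        by_contra hne
        have h1 : Λ \ interior Λ = Λ := by
          apply hm _ sdiff_subset (hc.sdiff isOpen_interior) (nonempty_iff_ne_empty.2 hne)
          rintro G hG x ⟨hx1, hx2⟩
          refine ⟨hi G hG x hx1, fun h => hx2 ?_⟩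
          have := inv_interior hi _ (L.inv_mem hG) _ h
          rwa [linv] at this
        apply hIntr
        rw [eq_empty_iff_forall_notMem]
        intro x hx
        have : x ∈ Λ \ interior Λ := h1.symm ▸ interior_subset hx
        exact this.2 hx
      have ho : IsOpen Λ := by
        have : interior Λ = Λ := interior_subset.antisymm (sdiff_eq_empty.1 hfr)
        rw [← this]; exact isOpen_interior
      exact IsClopen.eq_univ ⟨hc, ho⟩ hn
    intro X h1 h2 h3
    rw [← hu]
    exact hm X (by rw [hu]; exact subset_univ _) h1 h2 h3

end RotImg

namespace RotImg

/-- The group of all lifts of elements of `Γ`. -/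
def lifts (Γ : Subgroup (S1 ≃ₜ S1)) : Subgroup Lf where
  carrier := {F | ∃ f ∈ Γ, IsLiftOf (F : CircleDeg1Lift) f}
  mul_mem' := by
    rintro F G ⟨f, hf, hF⟩ ⟨g, hg, hG⟩
    refine ⟨f * g, Γ.mul_mem hf hg, fun x => ?_⟩
    show f (g x) = ((F (G x) : ℝ) : S1)
    rw [hG x, hF]
  one_mem' := ⟨1, Γ.one_mem, fun x => rfl⟩
  inv_mem' := by
    rintro F ⟨f, hf, hF⟩
    refine ⟨f⁻¹, Γ.inv_mem hf, fun x => ?_⟩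
    show f.symm x = (((F⁻¹ : Lf) x : ℝ) : S1)
    rw [Homeomorph.symm_apply_eq, hF, linv']

/-- Two lifts of the same map differ by an integer. -/
theorem lift_diff {F G : Lf} {f : S1 ≃ₜ S1} (hF : IsLiftOf (F : CircleDeg1Lift) f)
    (hG : IsLiftOf (G : CircleDeg1Lift) f) : ∃ n : ℤ, F = trans n * G := by
  have h1 : ∀ x : ℝ, ∃ n : ℤ, F x - G x = n := by
    intro x
    have h2 : ((F x : ℝ) : S1) = ((G x : ℝ) : S1) := by rw [← hF x, ← hG x]
    rw [QuotientAddGroup.eq] at h2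
    obtain ⟨n, hn⟩ := AddSubgroup.mem_zmultiples_iff.1 h2
    refine ⟨-n, ?_⟩
    push_cast
    simp only [zsmul_eq_mul, mul_one] at hn
    linarith
  choose n hn using h1
  have hc : Continuous (fun x => F x - G x) := (lcont F).sub (lcont G)
  have hc2 : Continuous (fun x => ((n x : ℤ) : ℝ)) := by
    have : (fun x => F x - G x) = fun x => ((n x : ℤ) : ℝ) := funext hn
    rwa [this] at hc
  have hc3 : Continuous n := Int.isClosedEmbedding_coe_real.isEmbedding.continuous_iff.2 hc2
  have hconst : ∀ x, n x = n 0 := fun x =>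
    PreconnectedSpace.constant inferInstance hc3
  refine ⟨n 0, lext fun x => ?_⟩
  rw [lmul, trans_apply]
  have := hn x
  rw [hconst x] at this
  linarith

theorem lifts_good {Γ : Subgroup (S1 ≃ₜ S1)} (hΓ : ∀ f ∈ Γ, IsAnalyticDiffeo f) :
    Good (lifts Γ) := by
  have key : ∀ F ∈ lifts Γ, AnalyticOnNhd ℝ (F : ℝ → ℝ) univ ∧ ∀ x, 0 < deriv (F : ℝ → ℝ) x := by
    rintro F ⟨f, hf, hF⟩
    obtain ⟨G, hG, h1, h2⟩ := hΓ f hf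
    obtain ⟨n, hn⟩ := lift_diff hF hG
    have h3 : (F : ℝ → ℝ) = fun x => G x + n := by
      funext x; rw [hn, lmul, trans_apply]
    rw [h3]
    refine ⟨h1.add analyticOnNhd_const, fun x => ?_⟩
    rw [deriv_add_const]; exact h2 x
  refine ⟨fun F hF => (key F hF).1, fun F hF => (key F hF).2, fun n => ⟨1, Γ.one_mem, fun x => ?_⟩⟩
  show (x : S1) = ((trans n x : ℝ) : S1)
  rw [trans_apply, QuotientAddGroup.eq]
  exact AddSubgroup.mem_zmultiples_iff.2 ⟨n, by simp⟩

theorem exists_lift {Γ : Subgroup (S1 ≃ₜ S1)} (hΓ : ∀ f ∈ Γ, IsAnalyticDiffeo f) {f : S1 ≃ₜ S1}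
    (hf : f ∈ Γ) : ∃ F ∈ lifts Γ, IsLiftOf (F : CircleDeg1Lift) f := by
  obtain ⟨G, hG, -⟩ := hΓ f hf
  exact ⟨G, ⟨f, hf, hG⟩, hG⟩

theorem no_finite {Γ : Subgroup (S1 ≃ₜ S1)} (hΓ : ∀ f ∈ Γ, IsAnalyticDiffeo f)
    (hmeas : ¬ HasInvariantProbMeasure Γ)
    (X : Set ℝ) (hX : X.Nonempty) (hi : Inv (lifts Γ) X) : ¬ (X ∩ Icc (0 : ℝ) 1).Finite := by
  intro hfin
  apply hmeas
  have hgood := lifts_good hΓ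
  set T : Set S1 := (fun x : ℝ => (x : S1)) '' X with hT
  have hTf : T.Finite := by
    refine (hfin.image (fun x : ℝ => (x : S1))).subset ?_
    rintro _ ⟨y, hy, rfl⟩
    refine ⟨trans (-⌊y⌋) y, ⟨hi _ (hgood.tr _) _ hy, ?_⟩, ?_⟩
    · rw [trans_apply]
      push_cast
      constructor
      · linarith [Int.floor_le y]
      · linarith [Int.lt_floor_add_one y]
    · show ((trans (-⌊y⌋) y : ℝ) : S1) = (y : S1)
      rw [trans_apply, QuotientAddGroup.eq]
      exact AddSubgroup.mem_zmultiples_iff.2 ⟨⌊y⌋, by simp⟩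
  have hTn : T.Nonempty := hX.image _
  have hTi : ∀ f ∈ Γ, ∀ t ∈ T, f t ∈ T := by
    rintro f hf _ ⟨y, hy, rfl⟩
    obtain ⟨F, hF, hFf⟩ := exists_lift hΓ hf
    refine ⟨F y, hi F hF y hy, ?_⟩
    exact (hFf y).symm
  have c0 : Measure.count T ≠ 0 := by
    rw [Ne, Measure.count_eq_zero_iff]; exact hTn.ne_empty
  have ct : Measure.count T ≠ ⊤ := (Measure.count_apply_lt_top.2 hTf).ne
  refine ⟨ProbabilityTheory.cond Measure.count T, ?_, ?_⟩
  · exact ProbabilityTheory.cond_isProbabilityMeasure_of_finite c0 ct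
  · intro f hf
    ext s hs
    rw [Measure.map_apply f.continuous.measurable hs, ProbabilityTheory.cond_apply hTf.measurableSet,
      ProbabilityTheory.cond_apply hTf.measurableSet]
    congr 1
    rw [← Measure.count_injective_image f.injective]
    congr 1
    ext y
    constructor
    · rintro ⟨x, ⟨hx1, hx2⟩, rfl⟩
      exact ⟨hTi f hf x hx1, hx2⟩
    · rintro ⟨h1, h2⟩
      refine ⟨f.symm y, ⟨hTi f⁻¹ (Γ.inv_mem hf) y h1, ?_⟩, f.apply_symm_apply y⟩
      show f (f.symm y) ∈ s
      rwa [f.apply_symm_apply]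

end RotImg

namespace RotImg

open BoundedContinuousFunction

/-- A probability measure on the circle from a positive density. -/
theorem exists_density {w : ℝ → ℝ} (hw : Continuous w) (hpos : ∀ x, 0 ≤ w x)
    (hIntr : ∫ x in (0 : ℝ)..1, w x = 1) :
    ∃ m : ProbabilityMeasure S1, ∀ ψ : S1 →ᵇ ℝ,
      ∫ z, ψ z ∂(m : Measure S1) = ∫ x in (0 : ℝ)..1, ψ (x : S1) * w x := by
  set ν : Measure ℝ := (volume.restrict (Ioc (0 : ℝ) 1)).withDensity (fun x => ENNReal.ofReal (w x))
    with hν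
  have hmeas : Measurable (fun x : ℝ => (x : S1)) := (AddCircle.continuous_mk' 1).measurable
  have hνp : IsProbabilityMeasure ν := by
    constructor
    rw [hν, withDensity_apply _ MeasurableSet.univ, Measure.restrict_univ]
    rw [← ofReal_integral_eq_lintegral_ofReal]
    · rw [← intervalIntegral.integral_of_le zero_le_one, hIntr, ENNReal.ofReal_one]
    · exact (hw.continuousOn.integrableOn_Icc).mono_set Ioc_subset_Icc_self
    · exact Eventually.of_forall hpos
  refine ⟨⟨Measure.map (fun x : ℝ => (x : S1)) ν,
    Measure.isProbabilityMeasure_map hmeas.aemeasurable⟩, fun ψ => ?_⟩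
  show ∫ z, ψ z ∂(Measure.map (fun x : ℝ => (x : S1)) ν) = _
  rw [integral_map hmeas.aemeasurable ψ.continuous.aestronglyMeasurable, hν,
    integral_withDensity_eq_integral_toReal_smul₀ (by fun_prop) (by simp),
    intervalIntegral.integral_of_le zero_le_one]
  refine integral_congr_ae (Eventually.of_forall fun x => ?_)
  simp only [smul_eq_mul]
  rw [ENNReal.toReal_ofReal (hpos x), mul_comm]

theorem density_almost_inv {L : Subgroup Lf} (hL : Good L) {w : ℝ → ℝ} (hw : Continuous w)
    (hper : ∀ x, w (x + 1) = w x)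
    (hIntr : ∫ x in (0 : ℝ)..1, w x = 1) {g : Lf} (hg : g ∈ L) {c : ℝ}
    (hw0 : ∀ x, 0 ≤ w x) (hc0 : 0 ≤ c) (hc : ∀ x, (1 - c) * w x ≤ deriv g x * w (g x))
    {Ψ : ℝ → ℝ} (hΨ : Continuous Ψ) (hΨp : ∀ x, Ψ (x + 1) = Ψ x) {M : ℝ} (hM : ∀ x, |Ψ x| ≤ M) :
    |(∫ x in (0 : ℝ)..1, Ψ (g x) * w x) - ∫ x in (0 : ℝ)..1, Ψ x * w x| ≤ 2 * c * M := by
  have hgc := lcont g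
  have hdc := hL.dcont hg
  have cov : ∀ Φ : ℝ → ℝ, Continuous Φ → (∀ x, Φ (x + 1) = Φ x) →
      ∫ x in (0 : ℝ)..1, Φ x * w x = ∫ x in (0 : ℝ)..1, Φ (g x) * (deriv g x * w (g x)) := by
    intro Φ hΦ hΦp
    have h1 := intervalIntegral.integral_comp_mul_deriv (a := 0) (b := 1) (f := g) (f' := deriv g)
      (g := fun x => Φ x * w x) (fun x _ => hL.diff hg x) hdc.continuousOn (hΦ.mul hw)
    have hp : Function.Periodic (fun x => Φ x * w x) 1 := fun x => by
      show Φ (x + 1) * w (x + 1) = Φ x * w x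
      rw [hΦp, hper]
    have h2 := hp.intervalIntegral_add_eq (g 0) 0
    have h3 : g 1 = g 0 + 1 := by rw [← ladd1]; simp
    rw [h3, h2, zero_add] at h1
    rw [← h1]
    apply intervalIntegral.integral_congr
    intro x _
    simp only [Function.comp]; ring
  have h1 := cov Ψ hΨ hΨp
  have h2 := cov (fun _ => 1) continuous_const (fun _ => rfl)
  simp only [one_mul] at h2
  rw [hIntr] at h2
  have hgw : Continuous (fun x => deriv g x * w (g x)) := hdc.mul (hw.comp hgc)
  have hΨg : Continuous (fun x => Ψ (g x)) := hΨ.comp hgc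
  have i1 : Continuous (fun x => Ψ (g x) * w x) := hΨg.mul hw
  have i2 : Continuous (fun x => Ψ (g x) * (deriv g x * w (g x))) := hΨg.mul hgw
  have i3 : Continuous (fun x => 2 * c * w x) := continuous_const.mul hw
  have i4 : Continuous (fun x => w x - deriv g x * w (g x)) := hw.sub hgw
  rw [h1, ← intervalIntegral.integral_sub (i1.intervalIntegrable _ _)
    (i2.intervalIntegrable _ _)]
  have hM0 : 0 ≤ M := (abs_nonneg _).trans (hM 0)
  have hA : ∀ x, |w x - deriv g x * w (g x)| ≤
      2 * c * w x - (w x - deriv g x * w (g x)) := by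
    intro x
    have h3 := hc x
    have h4 := mul_nonneg hc0 (hw0 x)
    rw [abs_le]; constructor <;> linarith
  calc |∫ x in (0 : ℝ)..1, Ψ (g x) * w x - Ψ (g x) * (deriv g x * w (g x))|
      ≤ ∫ x in (0 : ℝ)..1, M * (2 * c * w x - (w x - deriv g x * w (g x))) := by
        rw [← Real.norm_eq_abs]
        apply intervalIntegral.norm_integral_le_of_norm_le zero_le_one
        · refine Eventually.of_forall fun x _ => ?_
          rw [← mul_sub, Real.norm_eq_abs, abs_mul]
          exact mul_le_mul (hM _) (hA x) (abs_nonneg _) hM0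
        · exact (continuous_const.mul ((continuous_const.mul hw).sub (hw.sub hgw))).intervalIntegrable _ _
    _ = 2 * c * M := by
        rw [intervalIntegral.integral_const_mul, intervalIntegral.integral_sub
          (i3.intervalIntegrable _ _) (i4.intervalIntegrable _ _),
          intervalIntegral.integral_const_mul, intervalIntegral.integral_sub
          (hw.intervalIntegrable _ _) (hgw.intervalIntegrable _ _), hIntr, ← h2]
        ring

theorem claimA {Γ : Subgroup (S1 ≃ₜ S1)} (hΓ : ∀ f ∈ Γ, IsAnalyticDiffeo f)
    (hmeas : ¬ HasInvariantProbMeasure Γ) :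
    ∃ (S : Finset Lf) (c : ℝ), 0 < c ∧ (∀ g ∈ S, g ∈ lifts Γ) ∧
      ∀ φ : ℝ → ℝ, Continuous φ → (∀ x, φ (x + 1) = φ x) →
        ∃ g ∈ S, ∃ x, Real.log (deriv g x) + φ (g x) - φ x < -c := by
  by_contra hcon
  push Not at hcon
  apply hmeas
  have hL := lifts_good hΓ
  set K : Γ × ℕ → Set (ProbabilityMeasure S1) := fun i =>
    ⋂ ψ : S1 →ᵇ ℝ, {m | |(∫ z, ψ (i.1.1 z) ∂(m : Measure S1)) - ∫ z, ψ z ∂(m : Measure S1)|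
      ≤ 2 * (1 / ((i.2 : ℝ) + 1)) * ‖ψ‖} with hK
  have hKc : ∀ i, IsClosed (K i) := by
    intro i
    refine isClosed_iInter fun ψ => ?_
    refine isClosed_le ?_ continuous_const
    refine continuous_abs.comp (Continuous.sub ?_ ?_)
    · exact ProbabilityMeasure.continuous_integral_boundedContinuousFunction
        (ψ.compContinuous ⟨i.1.1, i.1.1.continuous⟩)
    · exact ProbabilityMeasure.continuous_integral_boundedContinuousFunction ψ
  have hne : (⋂ i, K i).Nonempty := by
    apply CompactSpace.iInter_nonempty hKc
    intro s
    choose! lift hl1 hl2 using fun (f : S1 ≃ₜ S1) (hf : f ∈ Γ) => exists_lift hΓ hf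
    obtain ⟨n, hn⟩ : ∃ n : ℕ, ∀ i ∈ s, i.2 ≤ n := ⟨s.sup (fun i => i.2), fun i hi =>
      Finset.le_sup (f := fun i : Γ × ℕ => i.2) hi⟩
    have hcp : 0 < 1 / ((n : ℝ) + 1) := by positivity
    obtain ⟨φ, hφ, hφp, hφi⟩ := hcon (s.image (fun i => lift i.1.1)) (1 / ((n : ℝ) + 1)) hcp (by
      intro g hg
      obtain ⟨i, -, rfl⟩ := Finset.mem_image.1 hg
      exact hl1 _ i.1.2)
    set Z := ∫ x in (0 : ℝ)..1, Real.exp (φ x) with hZ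
    have hec : Continuous (fun x => Real.exp (φ x)) := Real.continuous_exp.comp hφ
    have hZp : 0 < Z := intervalIntegral.intervalIntegral_pos_of_pos
      (hec.intervalIntegrable _ _) (fun x => Real.exp_pos _) zero_lt_one
    set w : ℝ → ℝ := fun x => Real.exp (φ x) / Z with hw
    have hwc : Continuous w := hec.div_const _
    have hwp : ∀ x, 0 < w x := fun x => div_pos (Real.exp_pos _) hZp
    have hwi : ∫ x in (0 : ℝ)..1, w x = 1 := by
      rw [hw, intervalIntegral.integral_div, ← hZ, div_self hZp.ne']
    have hwper : ∀ x, w (x + 1) = w x := fun x => by simp only [hw, hφp]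
    obtain ⟨m, hm⟩ := exists_density hwc (fun x => (hwp x).le) hwi
    refine ⟨m, ?_⟩
    simp only [mem_iInter]
    intro i hi
    refine mem_iInter.2 fun ψ => ?_
    show |(∫ z, ψ (i.1.1 z) ∂(m : Measure S1)) - ∫ z, ψ z ∂(m : Measure S1)|
      ≤ 2 * (1 / ((i.2 : ℝ) + 1)) * ‖ψ‖
    have e1 := hm (ψ.compContinuous ⟨i.1.1, i.1.1.continuous⟩)
    have e2 := hm ψ
    simp only [compContinuous_apply, ContinuousMap.coe_mk] at e1
    rw [e1, e2]
    have hlift := hl2 _ i.1.2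
    have e3 : ∀ x : ℝ, ψ (i.1.1 (x : S1)) = ψ ((lift i.1.1 x : ℝ) : S1) := fun x => by rw [hlift x]
    simp only [e3]
    have hb := density_almost_inv hL hwc hwper hwi (hl1 _ i.1.2) (c := 1 / ((n : ℝ) + 1))
      (fun x => (hwp x).le) hcp.le
      (Ψ := fun x => ψ (x : S1)) (M := ‖ψ‖) ?_ ?_ ?_ ?_
    · refine hb.trans ?_
      have h1 : (i.2 : ℝ) ≤ n := by exact_mod_cast hn i hi
      gcongr
    · intro x
      have h1 := hφi (lift i.1.1) (Finset.mem_image_of_mem _ hi) x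
      have hd := hL.dpos _ (hl1 _ i.1.2) x
      have h2 : Real.exp (-(1 / ((n : ℝ) + 1))) * Real.exp (φ x) ≤
          deriv (lift i.1.1) x * Real.exp (φ (lift i.1.1 x)) := by
        rw [← Real.exp_log hd, ← Real.exp_add, ← Real.exp_add]
        exact Real.exp_le_exp.2 (by linarith)
      have h3 := Real.add_one_le_exp (-(1 / ((n : ℝ) + 1)))
      simp only [hw]
      rw [← mul_div_assoc, ← mul_div_assoc]
      apply div_le_div_of_nonneg_right _ hZp.le
      refine le_trans ?_ h2
      apply mul_le_mul_of_nonneg_right _ (Real.exp_pos _).le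
      linarith
    · exact ψ.continuous.comp (AddCircle.continuous_mk' 1)
    · intro x
      have : ((x + 1 : ℝ) : S1) = (x : S1) := AddCircle.coe_add_period 1 x
      show ψ ((x + 1 : ℝ) : S1) = ψ (x : S1)
      rw [this]
    · intro x
      exact ψ.norm_coe_le_norm _
  obtain ⟨m, hm⟩ := hne
  refine ⟨m, inferInstance, fun γ hγ => ?_⟩
  have hpm : IsProbabilityMeasure (Measure.map γ (m : Measure S1)) :=
    Measure.isProbabilityMeasure_map γ.continuous.measurable.aemeasurable
  apply ext_of_forall_integral_eq_of_IsFiniteMeasure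
  intro ψ
  rw [integral_map γ.continuous.measurable.aemeasurable ψ.continuous.aestronglyMeasurable]
  have h1 : ∀ n : ℕ, |(∫ z, ψ (γ z) ∂(m : Measure S1)) - ∫ z, ψ z ∂(m : Measure S1)|
      ≤ 2 * (1 / ((n : ℝ) + 1)) * ‖ψ‖ := by
    intro n
    exact mem_iInter.1 (mem_iInter.1 hm (⟨γ, hγ⟩, n)) ψ
  have h2 : Tendsto (fun n : ℕ => 2 * (1 / ((n : ℝ) + 1)) * ‖ψ‖) atTop (𝓝 0) := by
    have := (tendsto_one_div_add_atTop_nhds_zero_nat (𝕜 := ℝ)).const_mul 2 |>.mul_const ‖ψ‖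
    simpa using this
  have h3 := ge_of_tendsto' h2 h1
  exact sub_eq_zero.1 (abs_eq_zero.1 (le_antisymm h3 (abs_nonneg _)))

end RotImg

namespace RotImg

/-- Value iteration for the minimal log-derivative along words. -/
def V (S : Finset Lf) (hS : S.Nonempty) (c : ℝ) : ℕ → ℝ → ℝ
  | 0 => fun _ => 0
  | n + 1 => fun x => min 0 (S.inf' hS (fun g => Real.log (deriv g x) + c + V S hS c n (g x)))

theorem V_cont {L : Subgroup Lf} (hL : Good L) (S : Finset Lf) (hS : S.Nonempty) (c : ℝ)
    (hSL : ∀ g ∈ S, g ∈ L) (n : ℕ) : Continuous (V S hS c n) := by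
  induction n with
  | zero => exact continuous_const
  | succ n ih =>
    refine continuous_const.min ?_
    apply Continuous.finset_inf'_apply
    intro g hg
    refine (Continuous.add ?_ continuous_const).add (ih.comp (lcont g))
    exact (hL.dcont (hSL g hg)).log fun x => (hL.dpos g (hSL g hg) x).ne'

theorem V_per (S : Finset Lf) (hS : S.Nonempty) (c : ℝ) (n : ℕ) (x : ℝ) :
    V S hS c n (x + 1) = V S hS c n x := by
  induction n generalizing x with
  | zero => rfl
  | succ n ih => simp only [V, dper, ladd1, ih]

theorem V_path (S : Finset Lf) (hS : S.Nonempty) (c : ℝ) (n : ℕ) (x : ℝ)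
    (h : V S hS c (n + 1) x < V S hS c n x) :
    ∃ (s : ℕ → Lf) (z : ℕ → ℝ), (∀ i < n + 1, s i ∈ S ∧ z (i + 1) = s i (z i)) ∧ z 0 = x ∧
      V S hS c (n + 1) x = ∑ i ∈ Finset.range (n + 1), (Real.log (deriv (s i) (z i)) + c) := by
  have h0 : ∀ m y, V S hS c m y ≤ 0 := by
    intro m y
    cases m with
    | zero => exact le_rfl
    | succ m => exact min_le_left _ _
  induction n generalizing x with
  | zero =>
    obtain ⟨g, hg, he⟩ := Finset.exists_mem_eq_inf' hS
      (fun g => Real.log (deriv g x) + c + V S hS c 0 (g x))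
    have h1 : V S hS c (0 + 1) x = Real.log (deriv g x) + c + V S hS c 0 (g x) := by
      have : V S hS c (0 + 1) x = min 0 _ := rfl
      rw [this, he] at h ⊢
      apply min_eq_right
      by_contra hc
      rw [min_eq_left (not_le.1 hc).le] at h
      exact absurd h (not_lt.2 (h0 _ _))
    refine ⟨fun _ => g, fun i => if i = 0 then x else g x, ?_, rfl, ?_⟩
    · intro i hi
      have : i = 0 := by omega
      subst this
      exact ⟨hg, by simp⟩
    · rw [h1]; simp [V]
  | succ n ih =>
    obtain ⟨g, hg, he⟩ := Finset.exists_mem_eq_inf' hS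
      (fun g => Real.log (deriv g x) + c + V S hS c (n + 1) (g x))
    have h1 : V S hS c (n + 1 + 1) x = Real.log (deriv g x) + c + V S hS c (n + 1) (g x) := by
      have : V S hS c (n + 1 + 1) x = min 0 _ := rfl
      rw [this, he] at h ⊢
      apply min_eq_right
      by_contra hc
      rw [min_eq_left (not_le.1 hc).le] at h
      exact absurd h (not_lt.2 (h0 _ _))
    have h2 : V S hS c (n + 1) x ≤ Real.log (deriv g x) + c + V S hS c n (g x) :=
      (min_le_right _ _).trans (Finset.inf'_le (fun g : Lf => Real.log (deriv g x) + c + V S hS c n (g x)) hg)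
    obtain ⟨s, z, hs, hz, hv⟩ := ih (g x) (by linarith)
    refine ⟨fun i => Nat.casesOn i g s, fun i => Nat.casesOn i x z, ?_, rfl, ?_⟩
    · intro i hi
      cases i with
      | zero => exact ⟨hg, hz⟩
      | succ i => exact hs i (by omega)
    · rw [h1, hv, Finset.sum_range_succ' _ (n + 1)]
      exact add_comm _ _

theorem pliss (b : ℕ → ℝ) (hb0 : b 0 = 0) {M : ℝ} (hM : 0 < M) {N K B : ℕ} (hB : 0 < B) (hK : 0 < K)
    (hst : ∀ k < N, b k - M ≤ b (k + 1)) (hbN : b N < -(M * (K * B : ℕ))) (z : ℕ → ℝ) :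
    ∃ i j, i + K ≤ j ∧ i < j ∧ j ≤ N ∧ (∀ k, i < k → k ≤ N → b k < b i) ∧
      ∃ n : ℤ, |z j - z i - n| ≤ 1 / B := by
  set I : ℕ → ℕ := fun q => Nat.findGreatest (fun k => -(M * q) ≤ b k) N with hI
  have hIle : ∀ q, I q ≤ N := fun q => Nat.findGreatest_le N
  have hIb : ∀ q : ℕ, -(M * q) ≤ b (I q) := by
    intro q
    have : -(M * (q : ℝ)) ≤ b 0 := by
      rw [hb0]; have : 0 ≤ M * (q : ℝ) := by positivity
      linarith
    exact Nat.findGreatest_spec (P := fun k => -(M * (q : ℝ)) ≤ b k) (Nat.zero_le N) this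
  have hIg : ∀ q k : ℕ, I q < k → k ≤ N → b k < -(M * q) := by
    intro q k h1 h2
    exact not_le.1 (Nat.findGreatest_is_greatest (P := fun k => -(M * (q : ℝ)) ≤ b k) h1 h2)
  have hIs : ∀ q, q < K * B → I q < I (q + 1) := by
    intro q hq
    have hlt : I q < N := by
      refine lt_of_le_of_ne (hIle q) fun he => ?_
      have h1 := hIb q
      rw [he] at h1
      have h2 : (q : ℝ) ≤ (K * B : ℕ) := by exact_mod_cast hq.le
      have := mul_le_mul_of_nonneg_left h2 hM.le
      linarith
    have h1 : -(M * ((q + 1 : ℕ) : ℝ)) ≤ b (I q + 1) := by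
      have := hst _ hlt
      have := hIb q
      push_cast
      linarith
    have := Nat.le_findGreatest (P := fun k => -(M * ((q + 1 : ℕ) : ℝ)) ≤ b k) hlt h1
    exact this
  have hIm : ∀ q d, q + d ≤ K * B → I q + d ≤ I (q + d) := by
    intro q d
    induction d with
    | zero => intro _; exact le_rfl
    | succ d ih =>
      intro h
      have h1 := ih (by omega)
      have h2 := hIs (q + d) (by omega)
      have h3 : I (q + d + 1) = I (q + (d + 1)) := rfl
      omega
  set bucket : ℕ → ℕ := fun p => ⌊Int.fract (z (I (K * p))) * B⌋₊ with hbk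
  have hBr : (0 : ℝ) < B := by exact_mod_cast hB
  have hmaps : ∀ p ∈ Finset.range (B + 1), bucket p ∈ Finset.range B := by
    intro p _
    rw [Finset.mem_range, hbk, Nat.floor_lt (by positivity)]
    have := Int.fract_lt_one (z (I (K * p)))
    nlinarith
  obtain ⟨p, hp, p', hp', hne, heq⟩ := Finset.exists_ne_map_eq_of_card_lt_of_maps_to
    (by simp) hmaps
  wlog hlt : p < p' generalizing p p'
  · exact this p' hp' p hp hne.symm heq.symm (by omega)
  rw [Finset.mem_range] at hp hp'
  have hKp : K * p + K * (p' - p) = K * p' := by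
    rw [← mul_add]; congr 1; omega
  have hK1 : K ≤ K * (p' - p) := Nat.le_mul_of_pos_right K (by omega)
  have hKB : K * p' ≤ K * B := Nat.mul_le_mul_left K (by omega)
  have h1 := hIm (K * p) (K * (p' - p)) (by omega)
  rw [hKp] at h1
  refine ⟨I (K * p), I (K * p'), by omega, ?_, hIle _, ?_, ?_⟩
  · omega
  · intro k h2 h3
    exact (hIg _ k h2 h3).trans_le (hIb _)
  · refine ⟨⌊z (I (K * p'))⌋ - ⌊z (I (K * p))⌋, ?_⟩
    have e1 : Int.fract (z (I (K * p'))) = z (I (K * p')) - ⌊z (I (K * p'))⌋ := rfl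
    have e2 : Int.fract (z (I (K * p))) = z (I (K * p)) - ⌊z (I (K * p))⌋ := rfl
    have f1 := Nat.floor_le (a := Int.fract (z (I (K * p'))) * B) (by positivity)
    have f2 := Nat.lt_floor_add_one (Int.fract (z (I (K * p'))) * B)
    have f3 := Nat.floor_le (a := Int.fract (z (I (K * p))) * B) (by positivity)
    have f4 := Nat.lt_floor_add_one (Int.fract (z (I (K * p))) * B)
    have f5 : ((⌊Int.fract (z (I (K * p))) * B⌋₊ : ℕ) : ℝ) = ⌊Int.fract (z (I (K * p'))) * B⌋₊ := by
      exact_mod_cast heq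
    rw [e1] at f1 f2 f5
    rw [e2] at f3 f4 f5
    rw [abs_le]
    push_cast
    constructor
    · rw [neg_le, le_div_iff₀ hBr]; nlinarith
    · rw [le_div_iff₀ hBr]; nlinarith

theorem exists_hyperbolic {L : Subgroup Lf} (hL : Good L) (S : Finset Lf) {c : ℝ} (hc : 0 < c)
    (hSL : ∀ g ∈ S, g ∈ L)
    (hA : ∀ φ : ℝ → ℝ, Continuous φ → (∀ x, φ (x + 1) = φ x) →
        ∃ g ∈ S, ∃ x, Real.log (deriv g x) + φ (g x) - φ x < -c) :
    ∃ g ∈ L, ∃ p, g p = p ∧ deriv g p < 1 := by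
  have hS : S.Nonempty := by
    obtain ⟨g, hg, -⟩ := hA (fun _ => 0) continuous_const (fun _ => rfl)
    exact ⟨g, hg⟩
  -- long words
  have words : ∀ n : ℕ, ∃ (s : ℕ → Lf) (z : ℕ → ℝ),
      (∀ i < n + 1, s i ∈ S ∧ z (i + 1) = s i (z i)) ∧
      ∑ i ∈ Finset.range (n + 1), (Real.log (deriv (s i) (z i)) + c) < 0 := by
    intro n
    obtain ⟨g, hg, x, hx⟩ := hA (V S hS c n) (V_cont hL S hS c hSL n) (V_per S hS c n)
    have h1 : V S hS c (n + 1) x ≤ Real.log (deriv g x) + c + V S hS c n (g x) :=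
      (min_le_right _ _).trans
        (Finset.inf'_le (fun g : Lf => Real.log (deriv g x) + c + V S hS c n (g x)) hg)
    have h2 : V S hS c (n + 1) x < V S hS c n x := by linarith
    obtain ⟨s, z, h3, -, h4⟩ := V_path S hS c n x h2
    refine ⟨s, z, h3, ?_⟩
    rw [← h4]
    refine h2.trans_le ?_
    cases n with
    | zero => exact le_rfl
    | succ m => exact min_le_left _ _
  -- uniform bounds
  have lcg : ∀ g ∈ S, Continuous (fun x => Real.log (deriv g x)) := fun g hg =>
    (hL.dcont (hSL g hg)).log fun x => (hL.dpos g (hSL g hg) x).ne'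
  have lper : ∀ g : Lf, Function.Periodic (fun x => Real.log (deriv g x)) 1 := fun g x => by
    show Real.log (deriv g (x + 1)) = Real.log (deriv g x)
    rw [dper]
  obtain ⟨M, hM0, hM⟩ : ∃ M : ℝ, 0 < M ∧ ∀ g ∈ S, ∀ x, |Real.log (deriv g x)| ≤ M := by
    have h1 : ∀ g ∈ S, ∃ M : ℝ, ∀ x, |Real.log (deriv g x)| ≤ M := fun g hg => by
      obtain ⟨C, hC⟩ := isCompact_Icc.exists_bound_of_continuousOn
        (s := Icc (0 : ℝ) 1) (lcg g hg).continuousOn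
      refine ⟨C, fun x => ?_⟩
      obtain ⟨y, hy, hxy⟩ := (lper g).exists_mem_Ico₀ one_pos x
      have := hC y ⟨hy.1, hy.2.le⟩
      rwa [hxy]
    choose! Mg hMg using h1
    refine ⟨1 + ∑ g ∈ S, |Mg g|, by positivity, fun g hg x => ?_⟩
    have h2 := Finset.single_le_sum (f := fun g => |Mg g|) (fun i _ => abs_nonneg _) hg
    have h3 := hMg g hg x
    have h4 := le_abs_self (Mg g)
    linarith
  obtain ⟨r, hr0, hr⟩ : ∃ r : ℝ, 0 < r ∧ ∀ g ∈ S, ∀ x y, |x - y| ≤ r →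
      Real.log (deriv g x) ≤ Real.log (deriv g y) + c / 4 := by
    have h1 : ∀ g ∈ S, ∃ r : ℝ, 0 < r ∧ ∀ x y, |x - y| ≤ r →
        Real.log (deriv g x) ≤ Real.log (deriv g y) + c / 4 := fun g hg => by
      have hu := (isCompact_Icc (a := (-1 : ℝ)) (b := 2)).uniformContinuousOn_of_continuous
        (lcg g hg).continuousOn
      rw [Metric.uniformContinuousOn_iff] at hu
      obtain ⟨δ, hδ, h⟩ := hu (c / 4) (by positivity)
      refine ⟨min (δ / 2) 1, by positivity, fun x y hxy => ?_⟩
      have hp : ∀ x, Real.log (deriv g x) = Real.log (deriv g (x - ⌊y⌋)) := fun x => by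
        have := (lper g).sub_int_mul_eq (x := x) ⌊y⌋
        rw [mul_one] at this
        exact this.symm
      rw [hp x, hp y]
      have hy1 := Int.floor_le y
      have hy2 := Int.lt_floor_add_one y
      have hx1 := abs_le.1 (hxy.trans (min_le_right _ _))
      have h3 := h (x - ⌊y⌋) ⟨by linarith, by linarith⟩ (y - ⌊y⌋) ⟨by linarith, by linarith⟩ (by
        rw [Real.dist_eq]
        have : x - (⌊y⌋ : ℝ) - (y - ⌊y⌋) = x - y := by ring
        rw [this]
        exact (hxy.trans (min_le_left _ _)).trans_lt (by linarith))
      rw [Real.dist_eq] at h3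
      have := (abs_lt.1 h3).2
      linarith
    choose! rg hrg hrg' using h1
    refine ⟨S.inf' hS rg, (Finset.lt_inf'_iff hS).2 hrg, fun g hg x y hxy => hrg' g hg x y
      (hxy.trans (Finset.inf'_le rg hg))⟩
  -- choice of the constants
  obtain ⟨B, hB⟩ := exists_nat_gt (2 / r)
  have hBr : (0 : ℝ) < B := lt_trans (by positivity) hB
  have hB0 : 0 < B := by exact_mod_cast hBr
  have hB1 : 1 / (B : ℝ) ≤ r / 2 := by
    rw [div_lt_iff₀ hr0] at hB
    rw [div_le_iff₀ hBr]
    linarith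
  obtain ⟨K, hK⟩ := exists_nat_gt (4 / c)
  have hKr : (0 : ℝ) < K := lt_trans (by positivity) hK
  have hK0 : 0 < K := by exact_mod_cast hKr
  have hK1 : 1 ≤ c / 4 * K := by
    rw [div_lt_iff₀ hc] at hK
    linarith
  obtain ⟨n, hn⟩ := exists_nat_gt ((M + c / 2) * (K * B : ℕ) / (c / 2))
  rw [div_lt_iff₀ (by positivity)] at hn
  obtain ⟨s, z, hsz, hsum⟩ := words n
  set b : ℕ → ℝ := fun k => ∑ l ∈ Finset.range k, (Real.log (deriv (s l) (z l)) + c / 2) with hb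
  have hbs : ∀ k, b (k + 1) = b k + (Real.log (deriv (s k) (z k)) + c / 2) := fun k =>
    Finset.sum_range_succ _ _
  have hbN : b (n + 1) < -((M + c / 2) * (K * B : ℕ)) := by
    have h1 : b (n + 1) = ∑ i ∈ Finset.range (n + 1), (Real.log (deriv (s i) (z i)) + c)
        - (n + 1 : ℕ) * (c / 2) := by
      simp only [hb, Finset.sum_add_distrib, Finset.sum_const, Finset.card_range, nsmul_eq_mul]
      ring
    rw [h1]
    push_cast at hn ⊢
    linarith
  obtain ⟨i, j, hij, hij', hjN, hdec, m, hm⟩ := pliss b (by simp [hb]) (M := M + c / 2)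
    (by positivity) hB0 hK0 (fun k hk => by
      rw [hbs]
      have := (abs_le.1 (hM (s k) (hsz k hk).1 (z k))).1
      linarith) hbN z
  -- the words
  set W : ℕ → Lf := fun d => Nat.rec 1 (fun d w => s (i + d) * w) d with hW
  have hW0 : W 0 = 1 := rfl
  have hWs : ∀ d, W (d + 1) = s (i + d) * W d := fun d => rfl
  have hWL : ∀ d, i + d ≤ n + 1 → W d ∈ L := by
    intro d
    induction d with
    | zero => intro _; exact one_mem L
    | succ d ih => intro h; exact mul_mem (hSL _ (hsz (i + d) (by omega)).1) (ih (by omega))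
  have hWz : ∀ d, i + d ≤ n + 1 → W d (z i) = z (i + d) := by
    intro d
    induction d with
    | zero => intro _; rfl
    | succ d ih =>
      intro h
      rw [hWs, lmul, ih (by omega), ← (hsz (i + d) (by omega)).2]
      rfl
  have hbi : ∀ d, i + d ≤ n + 1 → b (i + d) ≤ b i := by
    intro d hd
    cases d with
    | zero => exact le_rfl
    | succ d => exact (hdec _ (by omega) hd).le
  have mvt : ∀ (C : ℝ) (w : Lf), w ∈ L → (∀ x ∈ Icc (z i - r) (z i + r), deriv w x ≤ C) →
      ∀ x ∈ Icc (z i - r) (z i + r), |w x - w (z i)| ≤ C * |x - z i| := by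
    intro C w hw hC x hx
    have := Convex.norm_image_sub_le_of_norm_deriv_le (f := (w : ℝ → ℝ)) (C := C)
      (s := Icc (z i - r) (z i + r)) (x := z i) (y := x)
      (fun y _ => (hL.diff hw y).differentiableAt) (fun y hy => by
        rw [Real.norm_eq_abs, abs_of_pos (hL.dpos w hw y)]; exact hC y hy)
      (convex_Icc _ _) ⟨by linarith, by linarith⟩ hx
    exact this
  have main : ∀ d, i + d ≤ n + 1 → ∀ x ∈ Icc (z i - r) (z i + r),
      deriv (W d) x ≤ Real.exp (b (i + d) - b i - c / 4 * d) := by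
    intro d
    induction d with
    | zero =>
      intro _ x _
      have : ((W 0 : Lf) : ℝ → ℝ) = id := rfl
      rw [this, deriv_id]
      simp
    | succ d ih =>
      intro h x hx
      have h1 := ih (by omega)
      have h2 : ∀ y ∈ Icc (z i - r) (z i + r), deriv (W d) y ≤ 1 := fun y hy =>
        (h1 y hy).trans (by
          rw [Real.exp_le_one_iff]
          have := hbi d (by omega)
          have : 0 ≤ c / 4 * (d : ℝ) := by positivity
          linarith)
      have h3 := mvt 1 _ (hWL d (by omega)) h2 x hx
      rw [hWz d (by omega), one_mul] at h3
      have h4 : |x - z i| ≤ r := abs_le.2 ⟨by linarith [hx.1], by linarith [hx.2]⟩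
      obtain ⟨h5, -⟩ := hsz (i + d) (by omega)
      have h6 := hr _ h5 _ _ (h3.trans h4)
      rw [hWs, hL.dmul (hSL _ h5) (hWL d (by omega))]
      have h7 : deriv (s (i + d)) (W d x) ≤ Real.exp (Real.log (deriv (s (i + d)) (z (i + d))) + c / 4) := by
        rw [← Real.log_le_iff_le_exp (hL.dpos _ (hSL _ h5) _)]
        exact h6
      calc _ ≤ Real.exp (Real.log (deriv (s (i + d)) (z (i + d))) + c / 4) *
            Real.exp (b (i + d) - b i - c / 4 * d) :=
            mul_le_mul h7 (h1 x hx) (hL.dpos _ (hWL d (by omega)) x).le (Real.exp_pos _).le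
        _ = _ := by
            rw [← Real.exp_add]
            congr 1
            have := hbs (i + d)
            have e : i + (d + 1) = i + d + 1 := rfl
            rw [e, this]
            push_cast
            ring
  obtain ⟨d, rfl⟩ : ∃ d, j = i + d := ⟨j - i, by omega⟩
  have hdK : (K : ℝ) ≤ d := by exact_mod_cast (by omega : K ≤ d)
  have half : ∀ x ∈ Icc (z i - r) (z i + r), deriv (W d) x ≤ 1 / 2 := fun x hx =>
    (main d hjN x hx).trans (by
      have h1 : b (i + d) - b i - c / 4 * d ≤ -1 := by
        have := hbi d hjN
        have := mul_le_mul_of_nonneg_left hdK (by positivity : 0 ≤ c / 4)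
        linarith
      have h2 : Real.exp (-1) ≤ 1 / 2 := by
        rw [Real.exp_neg, one_div]
        apply inv_anti₀ two_pos
        have := Real.add_one_le_exp (1 : ℝ)
        linarith
      exact (Real.exp_le_exp.2 h1).trans h2)
  have hgL : trans (-m) * W d ∈ L := mul_mem (hL.tr _) (hWL d hjN)
  have hgx : ∀ x, (trans (-m) * W d : Lf) x = W d x - m := fun x => by
    rw [lmul, trans_apply]; push_cast; ring
  have hmaps : MapsTo (trans (-m) * W d : Lf) (Icc (z i - r) (z i + r)) (Icc (z i - r) (z i + r)) := by
    intro x hx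
    have h1 := abs_le.1 (mvt _ _ (hWL d hjN) half x hx)
    rw [hWz d hjN] at h1
    have h4 : |x - z i| ≤ r := abs_le.2 ⟨by linarith [hx.1], by linarith [hx.2]⟩
    have h5 := abs_le.1 (hm.trans hB1)
    rw [hgx]
    constructor <;> linarith
  obtain ⟨p, hp, hpf⟩ := exists_mem_Icc_isFixedPt_of_mapsTo
    (lcont (trans (-m) * W d)).continuousOn (by linarith) hmaps
  refine ⟨_, hgL, p, hpf, ?_⟩
  have : ((trans (-m) * W d : Lf) : ℝ → ℝ) = fun x => W d x - m := funext hgx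
  rw [this, deriv_sub_const]
  exact (half p hp).trans_lt (by norm_num)

end RotImg

namespace RotImg

/-- A `C¹` linearizing chart at a hyperbolic fixed point. -/
structure IsChart (g : Lf) (p lam w : ℝ) (φ D : ℝ → ℝ) : Prop where
  lam0 : 0 < lam
  lam1 : lam < 1
  w0 : 0 < w
  Dc : Continuous D
  Dpos : ∀ x, 0 < D x
  der : ∀ x, HasDerivAt φ (D x) x
  surj : Function.Surjective φ
  zero : φ p = 0
  lin : ∀ x, |φ x| ≤ w → φ (g x) = lam * φ x
  dlin : ∀ x, |φ x| ≤ w → D (g x) * deriv g x = lam * D x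

theorem IsChart.mono {g : Lf} {p lam w : ℝ} {φ D : ℝ → ℝ} (h : IsChart g p lam w φ D) :
    StrictMono φ := by
  apply strictMono_of_deriv_pos
  intro x
  rw [(h.der x).deriv]
  exact h.Dpos x

theorem IsChart.cont {g : Lf} {p lam w : ℝ} {φ D : ℝ → ℝ} (h : IsChart g p lam w φ D) :
    Continuous φ :=
  continuous_iff_continuousAt.2 fun x => (h.der x).continuousAt

theorem linearize {L : Subgroup Lf} (hL : Good L) {g : Lf} (hg : g ∈ L) {p : ℝ} (hp : g p = p)
    (hd : deriv g p < 1) : ∃ lam w φ D, IsChart g p lam w φ D := by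
  set lam := deriv g p with hlam
  have hlam0 : 0 < lam := hL.dpos g hg p
  set ν := (1 + lam) / 2 with hν
  have hν0 : 0 < ν := by positivity
  have hν1 : ν < 1 := by rw [hν]; linarith
  have hνl : lam < ν := by rw [hν]; linarith
  -- regularity of log g'
  have hreg : ContDiffAt ℝ 1 (fun x => Real.log (deriv g x)) p := by
    have h1 : ContDiffAt ℝ 1 (deriv g) p := ((hL.an g hg).deriv p (mem_univ p)).contDiffAt
    exact h1.log (hL.dpos g hg p).ne'
  obtain ⟨C, t, ht, hC⟩ := hreg.exists_lipschitzOnWith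
  have hev : ∀ᶠ x in 𝓝 p, x ∈ t ∧ deriv g x < ν :=
    Filter.Eventually.and (p := fun x => x ∈ t) ht ((hL.dcont hg).continuousAt.eventually_lt_const hνl)
  obtain ⟨v', hv', hv⟩ := Metric.eventually_nhds_iff.1 hev
  set v := v' / 2 with hvdef
  have hv0 : 0 < v := by positivity
  have hvt : ∀ x ∈ Icc (p - v) (p + v), x ∈ t ∧ deriv g x < ν := fun x hx => hv (by
    rw [Real.dist_eq]
    have : |x - p| ≤ v := abs_le.2 ⟨by linarith [hx.1], by linarith [hx.2]⟩
    linarith)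
  have hpI : p ∈ Icc (p - v) (p + v) := ⟨by linarith, by linarith⟩
  have hcontr : ∀ x ∈ Icc (p - v) (p + v), |g x - p| ≤ ν * |x - p| := by
    intro x hx
    have := Convex.norm_image_sub_le_of_norm_deriv_le (f := (g : ℝ → ℝ)) (C := ν)
      (s := Icc (p - v) (p + v)) (x := p) (y := x)
      (fun y _ => (hL.diff hg y).differentiableAt) (fun y hy => by
        rw [Real.norm_eq_abs, abs_of_pos (hL.dpos g hg y)]; exact (hvt y hy).2.le)
      (convex_Icc _ _) hpI hx
    rw [hp] at this
    exact this
  have hmem : ∀ x, x ∈ Icc (p - v) (p + v) ↔ |x - p| ≤ v := fun x => by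
    rw [abs_le]
    constructor
    · rintro ⟨h1, h2⟩; constructor <;> linarith
    · rintro ⟨h1, h2⟩; constructor <;> linarith
  have hmaps : ∀ x ∈ Icc (p - v) (p + v), g x ∈ Icc (p - v) (p + v) := by
    intro x hx
    rw [hmem] at hx ⊢
    have := hcontr x ((hmem x).2 hx)
    have := mul_le_of_le_one_left (abs_nonneg (x - p)) hν1.le
    linarith
  have hit : ∀ i : ℕ, ∀ x ∈ Icc (p - v) (p + v), (g ^ i : Lf) x ∈ Icc (p - v) (p + v) ∧
      |(g ^ i : Lf) x - p| ≤ ν ^ i * v := by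
    intro i
    induction i with
    | zero => intro x hx; exact ⟨hx, by rw [pow_zero, pow_zero, one_mul, lone]; exact (hmem x).1 hx⟩
    | succ i ih =>
      intro x hx
      obtain ⟨h1, h2⟩ := ih x hx
      rw [lpow_succ]
      refine ⟨hmaps _ h1, (hcontr _ h1).trans ?_⟩
      rw [pow_succ', mul_assoc]
      exact mul_le_mul_of_nonneg_left h2 hν0.le
  set pr : ℝ → ℝ := fun x => max (p - v) (min x (p + v)) with hpr
  have hprc : Continuous pr := by fun_prop
  have hprI : ∀ x, pr x ∈ Icc (p - v) (p + v) := fun x =>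
    ⟨le_max_left _ _, max_le (by linarith) (min_le_right _ _)⟩
  have hprx : ∀ x ∈ Icc (p - v) (p + v), pr x = x := fun x hx => by
    rw [hpr]; dsimp only; rw [min_eq_left hx.2, max_eq_right hx.1]
  set e : ℕ → ℝ → ℝ := fun i x => Real.log (deriv g ((g ^ i : Lf) (pr x))) - Real.log lam with he
  have hec : ∀ i, Continuous (e i) := fun i =>
    (((hL.dcont hg).comp ((lcont _).comp hprc)).log fun x => (hL.dpos g hg _).ne').sub
      continuous_const
  have heb : ∀ i x, ‖e i x‖ ≤ C * v * ν ^ i := by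
    intro i x
    obtain ⟨h1, h2⟩ := hit i (pr x) (hprI x)
    have h3 := hC.dist_le_mul _ (hvt _ h1).1 _ (hvt _ hpI).1
    rw [Real.dist_eq, Real.dist_eq] at h3
    refine h3.trans ?_
    have := mul_le_mul_of_nonneg_left h2 C.coe_nonneg
    linarith
  have hsum : Summable fun i : ℕ => (C : ℝ) * v * ν ^ i :=
    (summable_geometric_of_lt_one hν0.le hν1).mul_left _
  set E : ℝ → ℝ := fun x => ∑' i, e i x with hE
  have hEc : Continuous E := continuous_tsum hec hsum heb
  have hes : ∀ x, Summable fun i => e i x := fun x =>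
    Summable.of_norm_bounded hsum (fun i => heb i x)
  have hEb : ∀ x, |E x| ≤ ∑' i : ℕ, (C : ℝ) * v * ν ^ i := fun x =>
    tsum_of_norm_bounded hsum.hasSum (fun i => heb i x)
  set B := ∑' i : ℕ, (C : ℝ) * v * ν ^ i with hB
  have hshift : ∀ x ∈ Icc (p - v) (p + v), E x = Real.log (deriv g x) - Real.log lam + E (g x) := by
    intro x hx
    have h1 := (hes x).tsum_eq_zero_add
    have h2 : ∀ i, e (i + 1) x = e i (g x) := fun i => by
      simp only [he]
      rw [hprx x hx, hprx _ (hmaps x hx), lpow_succ']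
    simp only [h2] at h1
    rw [hE]
    dsimp only
    rw [h1]
    congr 1
    simp only [he]
    rw [hprx x hx, pow_zero, lone]
  set D : ℝ → ℝ := fun x => Real.exp (E x) with hD
  have hDc : Continuous D := hEc.rexp
  set φ : ℝ → ℝ := fun x => ∫ t in p..x, D t with hφ
  have hder : ∀ x, HasDerivAt φ (D x) x := fun x =>
    intervalIntegral.integral_hasDerivAt_right (hDc.intervalIntegrable _ _)
      (hDc.stronglyMeasurableAtFilter _ _) hDc.continuousAt
  have hdlin : ∀ x ∈ Icc (p - v) (p + v), D (g x) * deriv g x = lam * D x := by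
    intro x hx
    rw [hD]
    dsimp only
    rw [hshift x hx, Real.exp_add, Real.exp_sub, Real.exp_log (hL.dpos g hg x), Real.exp_log hlam0]
    field_simp
  have hlin : ∀ x ∈ Icc (p - v) (p + v), φ (g x) = lam * φ x := by
    intro x hx
    have h1 := intervalIntegral.integral_comp_mul_deriv (a := p) (b := x) (f := (g : ℝ → ℝ))
      (f' := deriv g) (g := D) (fun y _ => hL.diff hg y) (hL.dcont hg).continuousOn hDc
    rw [hp] at h1
    rw [hφ]
    dsimp only
    rw [← h1, ← intervalIntegral.integral_const_mul]
    apply intervalIntegral.integral_congr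
    intro y hy
    exact hdlin y (ordConnected_Icc.uIcc_subset hpI hx hy)
  have hmono : StrictMono φ := by
    apply strictMono_of_deriv_pos
    intro x
    rw [(hder x).deriv]
    exact Real.exp_pos _
  have hφc : Continuous φ := continuous_iff_continuousAt.2 fun x => (hder x).continuousAt
  have hφp : φ p = 0 := intervalIntegral.integral_same
  have hlow : ∀ x, Real.exp (-B) ≤ D x := fun x =>
    Real.exp_le_exp.2 (abs_le.1 (hEb x)).1
  have hlb : Monotone fun x => φ x - Real.exp (-B) * x := by
    apply monotone_of_deriv_nonneg
    · intro x
      exact ((hder x).sub ((hasDerivAt_id x).const_mul _)).differentiableAt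
    · intro x
      have := ((hder x).sub ((hasDerivAt_id x).const_mul (Real.exp (-B)))).deriv
      have h2 : deriv (fun x => φ x - Real.exp (-B) * x) x = D x - Real.exp (-B) * 1 := this
      rw [h2]
      linarith [hlow x]
  have hsurj : Function.Surjective φ := by
    have hb := Real.exp_pos (-B)
    apply hφc.surjective
    · have : Tendsto (fun x => Real.exp (-B) * (x - p)) atTop atTop :=
        (tendsto_atTop_add_const_right _ _ tendsto_id).const_mul_atTop hb
      refine tendsto_atTop_mono' _ ?_ this
      filter_upwards [eventually_ge_atTop p] with x hx
      have := hlb hx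
      dsimp only at this
      linarith
    · have : Tendsto (fun x => Real.exp (-B) * (x - p)) atBot atBot :=
        (tendsto_atBot_add_const_right _ _ tendsto_id).const_mul_atBot hb
      refine tendsto_atBot_mono' _ ?_ this
      filter_upwards [eventually_le_atBot p] with x hx
      have := hlb hx
      dsimp only at this
      linarith
  have h1 : 0 < φ (p + v) := by rw [← hφp]; exact hmono (by linarith)
  have h2 : φ (p - v) < 0 := by rw [← hφp]; exact hmono (by linarith)
  have hin : ∀ x, |φ x| ≤ min (φ (p + v)) (-φ (p - v)) → x ∈ Icc (p - v) (p + v) := by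
    intro x hx
    have h3 := (abs_le.1 (hx.trans (min_le_left _ _))).2
    have h4 := (abs_le.1 (hx.trans (min_le_right _ _))).1
    exact ⟨hmono.le_iff_le.1 (by linarith), hmono.le_iff_le.1 h3⟩
  exact ⟨lam, min (φ (p + v)) (-φ (p - v)), φ, D, hlam0, hd, lt_min h1 (by linarith), hDc,
    fun x => Real.exp_pos _, hder, hsurj, hφp, fun x hx => hlin x (hin x hx),
    fun x hx => hdlin x (hin x hx)⟩

end RotImg

namespace RotImg

theorem Dratio {D : ℝ → ℝ} (hc : Continuous D) (hpos : ∀ x, 0 < D x) (a b : ℝ) {ε : ℝ}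
    (hε : 0 < ε) : ∃ η > 0, ∀ x ∈ Icc a b, ∀ y, |y - x| ≤ η → |D y - D x| ≤ ε * D x := by
  by_cases hab : a ≤ b
  swap
  · exact ⟨1, one_pos, fun x hx => absurd (hx.1.trans hx.2) hab⟩
  obtain ⟨x0, -, hx0⟩ := (isCompact_Icc (a := a) (b := b)).exists_isMinOn
    (nonempty_Icc.2 hab) hc.continuousOn
  have hu := (isCompact_Icc (a := a - 1) (b := b + 1)).uniformContinuousOn_of_continuous
    hc.continuousOn
  rw [Metric.uniformContinuousOn_iff] at hu
  obtain ⟨δ, hδ, h⟩ := hu (ε * D x0) (mul_pos hε (hpos x0))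
  refine ⟨min (δ / 2) 1, by positivity, fun x hx y hxy => ?_⟩
  have hx1 := abs_le.1 (hxy.trans (min_le_right _ _))
  have h3 := h y ⟨by linarith [hx.1], by linarith [hx.2]⟩ x
    ⟨by linarith [hx.1], by linarith [hx.2]⟩ (by
      rw [Real.dist_eq]
      exact (hxy.trans (min_le_left _ _)).trans_lt (by linarith))
  rw [Real.dist_eq] at h3
  exact h3.le.trans (mul_le_mul_of_nonneg_left (hx0 hx) hε.le)

theorem ratio_arith {Dx Dy DG DF f G ε η : ℝ} (hDx : 0 < Dx) (hDy : 0 < Dy) (hDG : 0 < DG)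
    (hDF : 0 < DF) (hf : 0 < f) (hG : 0 < G) (hε : 0 < ε) (q4 : ε ≤ 1 / 4) (q8 : ε ≤ η / 8)
    (r1 : |DG - Dx| ≤ ε * Dx) (r2 : |DF - Dy| ≤ ε * Dy) (r3 : |f - 1| ≤ ε)
    (e4 : DG * G * Dy = DF * f * Dx) : |G - 1| ≤ η := by
  rw [abs_le] at r1 r2 r3 ⊢
  have up : (1 - ε) * G ≤ (1 + ε) * (1 + ε) := by
    have a1 : (1 - ε) * Dx * G * Dy ≤ DG * G * Dy := by
      gcongr; linarith
    have a2 : DF * f * Dx ≤ ((1 + ε) * Dy) * (1 + ε) * Dx := by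
      gcongr <;> linarith
    have : (Dx * Dy) * ((1 - ε) * G) ≤ (Dx * Dy) * ((1 + ε) * (1 + ε)) := by
      calc _ = (1 - ε) * Dx * G * Dy := by ring
        _ ≤ ((1 + ε) * Dy) * (1 + ε) * Dx := by linarith
        _ = _ := by ring
    exact le_of_mul_le_mul_left this (by positivity)
  have lo : (1 - ε) * (1 - ε) ≤ (1 + ε) * G := by
    have a1 : DG * G * Dy ≤ (1 + ε) * Dx * G * Dy := by
      gcongr; linarith
    have a2 : ((1 - ε) * Dy) * (1 - ε) * Dx ≤ DF * f * Dx := by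
      have : 0 ≤ 1 - ε := by linarith
      gcongr <;> linarith
    have : (Dx * Dy) * ((1 - ε) * (1 - ε)) ≤ (Dx * Dy) * ((1 + ε) * G) := by
      calc _ = ((1 - ε) * Dy) * (1 - ε) * Dx := by ring
        _ ≤ (1 + ε) * Dx * G * Dy := by linarith
        _ = _ := by ring
    exact le_of_mul_le_mul_left this (by positivity)
  have hG8 : G ≤ 1 + 8 * ε := by nlinarith
  have hG8' : 1 - 8 * ε ≤ G := by nlinarith
  constructor <;> linarith

/-- `C¹` closeness to the identity on a set. -/
def Cl (F : Lf) (S : Set ℝ) (η : ℝ) : Prop := ∀ x ∈ S, |F x - x| ≤ η ∧ |deriv F x - 1| ≤ η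

section
variable {g : Lf} {p lam w : ℝ} {φ D : ℝ → ℝ}

theorem IsChart.nhds (h : IsChart g p lam w φ D) {S : Set ℝ} (hS : S ∈ 𝓝 p) :
    ∃ w' > 0, w' ≤ w ∧ ∀ x, |φ x| ≤ w' → x ∈ S := by
  obtain ⟨δ', hδ', hb⟩ := Metric.mem_nhds_iff.1 hS
  set δ := δ' / 2
  have hδ : 0 < δ := by positivity
  have h1 : 0 < φ (p + δ) := by rw [← h.zero]; exact h.mono (by linarith)
  have h2 : φ (p - δ) < 0 := by rw [← h.zero]; exact h.mono (by linarith)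
  refine ⟨min w (min (φ (p + δ)) (-φ (p - δ))), lt_min h.w0 (lt_min h1 (by linarith)),
    min_le_left _ _, fun x hx => ?_⟩
  have h3 := (abs_le.1 (hx.trans ((min_le_right _ _).trans (min_le_left _ _)))).2
  have h4 := (abs_le.1 (hx.trans ((min_le_right _ _).trans (min_le_right _ _)))).1
  have h5 : p - δ ≤ x := h.mono.le_iff_le.1 (by linarith)
  have h6 : x ≤ p + δ := h.mono.le_iff_le.1 h3
  apply hb
  rw [Metric.mem_ball, Real.dist_eq, abs_lt]
  constructor
  · show -δ' < _
    have : δ = δ' / 2 := rfl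
    linarith
  · have : δ = δ' / 2 := rfl
    linarith

theorem IsChart.itlin (h : IsChart g p lam w φ D) (m : ℕ) {x : ℝ} (hx : |φ x| ≤ w) :
    φ ((g ^ m : Lf) x) = lam ^ m * φ x ∧ |φ ((g ^ m : Lf) x)| ≤ |φ x| := by
  induction m with
  | zero => rw [pow_zero, lone]; simp
  | succ m ih =>
    obtain ⟨h1, h2⟩ := ih
    rw [lpow_succ]
    have h3 := h.lin _ (h2.trans hx)
    refine ⟨by rw [h3, h1, pow_succ']; ring, ?_⟩
    rw [h3, abs_mul, abs_of_pos h.lam0]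
    exact (mul_le_of_le_one_left (abs_nonneg _) h.lam1.le).trans h2

theorem IsChart.itdlin {L : Subgroup Lf} (hL : Good L) (hg : g ∈ L)
    (h : IsChart g p lam w φ D) (m : ℕ) {x : ℝ} (hx : |φ x| ≤ w) :
    D ((g ^ m : Lf) x) * deriv (g ^ m : Lf) x = lam ^ m * D x := by
  induction m with
  | zero =>
    have : ((g ^ 0 : Lf) : ℝ → ℝ) = id := rfl
    rw [this, deriv_id]
    simp
  | succ m ih =>
    rw [lpow_succ, pow_succ' g, hL.dmul hg (pow_mem hg m)]
    have h3 := h.dlin _ ((h.itlin m hx).2.trans hx)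
    rw [← mul_assoc, h3, mul_assoc, ih, pow_succ']
    ring

/-- the conjugate by a power of the contraction, in the chart -/
theorem IsChart.conj (h : IsChart g p lam w φ D) (F : Lf) (m : ℕ) {x u : ℝ}
    (hu : |u| ≤ w) (he : φ (F ((g ^ m : Lf) x)) = lam ^ m * u) :
    φ (((g ^ m)⁻¹ * F * g ^ m : Lf) x) = u := by
  obtain ⟨y, rfl⟩ := h.surj u
  rw [← (h.itlin m hu).1] at he
  have := h.mono.injective he
  rw [lmul, lmul, this, linv]

theorem IsChart.expand (h : IsChart g p lam w φ D) (a b : ℝ) :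
    ∃ m0 > 0, ∀ x ∈ Icc a b, ∀ y ∈ Icc a b, m0 * |x - y| ≤ |φ x - φ y| := by
  by_cases hab : a ≤ b
  swap
  · exact ⟨1, one_pos, fun x hx => absurd (hx.1.trans hx.2) hab⟩
  obtain ⟨x0, -, hx0⟩ := (isCompact_Icc (a := a) (b := b)).exists_isMinOn
    (nonempty_Icc.2 hab) h.Dc.continuousOn
  refine ⟨D x0, h.Dpos x0, ?_⟩
  have key : ∀ x ∈ Icc a b, ∀ y ∈ Icc a b, x < y → D x0 * |x - y| ≤ |φ x - φ y| := by
    intro x hx y hy hxy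
    obtain ⟨c, hc, he⟩ := exists_hasDerivAt_eq_slope φ D hxy h.cont.continuousOn
      (fun z _ => h.der z)
    have h1 : D x0 ≤ D c := hx0 (show c ∈ Icc a b from
      ⟨hx.1.trans hc.1.le, hc.2.le.trans hy.2⟩)
    rw [he, le_div_iff₀ (by linarith)] at h1
    have := h.mono hxy
    rw [abs_of_neg (by linarith), abs_of_neg (by linarith)]
    linarith
  intro x hx y hy
  rcases lt_trichotomy x y with hxy | hxy | hxy
  · exact key x hx y hy hxy
  · subst hxy; simp
  · rw [abs_sub_comm, abs_sub_comm (φ x)]; exact key y hy x hx hxy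

theorem IsChart.lip {L : Subgroup Lf} (hL : Good L)
    (h : IsChart g p lam w φ D) (a b : ℝ) {ε : ℝ} (hε : 0 < ε) :
    ∃ η > 0, ∀ F ∈ L, Cl F (Icc a b) η → ∀ x ∈ Icc a b, ∀ y ∈ Icc a b,
      |φ (F x) - φ (F y) - (φ x - φ y)| ≤ ε * |φ x - φ y| := by
  obtain ⟨η0, hη0, hr⟩ := Dratio h.Dc h.Dpos a b (ε := ε / 3) (by positivity)
  refine ⟨min η0 (ε / (3 + ε)), by positivity, fun F hF hcl => ?_⟩
  have hdb : ∀ x ∈ Icc a b, |D (F x) * deriv F x - D x| ≤ ε * D x := by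
    intro x hx
    have h1 := abs_le.1 (hr x hx (F x) ((hcl x hx).1.trans (min_le_left _ _)))
    have h2 := ((hcl x hx).2.trans (min_le_right _ _))
    have h3 := h.Dpos x
    have h4 := h.Dpos (F x)
    have h5 : |D (F x) * (deriv F x - 1)| ≤ ε / 3 * D x := by
      rw [abs_mul, abs_of_pos h4]
      calc D (F x) * |deriv F x - 1| ≤ ((1 + ε / 3) * D x) * (ε / (3 + ε)) :=
            mul_le_mul (by linarith) h2 (abs_nonneg _) (by positivity)
        _ = ε / 3 * D x := by field_simp
    have h6 := abs_le.1 h5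
    rw [abs_le]
    have : ε * D x = ε / 3 * D x * 3 := by ring
    have : 0 < ε / 3 * D x := by positivity
    constructor <;> nlinarith
  have hd : ∀ x, HasDerivAt (fun x => φ (F x) - φ x) (D (F x) * deriv F x - D x) x := fun x =>
    ((h.der (F x)).comp x (hL.diff hF x)).sub (h.der x)
  have m1 : MonotoneOn (fun x => ε * φ x - (φ (F x) - φ x)) (Icc a b) := by
    apply monotoneOn_of_deriv_nonneg (convex_Icc a b)
    · exact ((h.cont.const_mul ε).continuousOn).sub (HasDerivAt.continuousOn fun x _ => hd x)
    · intro x _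
      exact (((h.der x).const_mul ε).sub (hd x)).differentiableAt.differentiableWithinAt
    · intro x hx
      have : deriv (fun x => ε * φ x - (φ (F x) - φ x)) x = _ :=
        (((h.der x).const_mul ε).sub (hd x)).deriv
      rw [this]
      have := (abs_le.1 (hdb x (interior_subset hx))).2
      linarith
  have m2 : MonotoneOn (fun x => ε * φ x + (φ (F x) - φ x)) (Icc a b) := by
    apply monotoneOn_of_deriv_nonneg (convex_Icc a b)
    · exact ((h.cont.const_mul ε).continuousOn).add (HasDerivAt.continuousOn fun x _ => hd x)
    · intro x _
      exact (((h.der x).const_mul ε).add (hd x)).differentiableAt.differentiableWithinAt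
    · intro x hx
      have : deriv (fun x => ε * φ x + (φ (F x) - φ x)) x = _ :=
        (((h.der x).const_mul ε).add (hd x)).deriv
      rw [this]
      have := (abs_le.1 (hdb x (interior_subset hx))).1
      linarith
  have key : ∀ x ∈ Icc a b, ∀ y ∈ Icc a b, x ≤ y →
      |φ (F x) - φ (F y) - (φ x - φ y)| ≤ ε * |φ x - φ y| := by
    intro x hx y hy hxy
    have h1 := m1 hx hy hxy
    have h2 := m2 hx hy hxy
    dsimp only at h1 h2
    have h3 := h.mono.monotone hxy
    rw [abs_of_nonpos (a := φ x - φ y) (by linarith), abs_le]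
    constructor <;> linarith
  intro x hx y hy
  rcases le_total x y with hxy | hxy
  · exact key x hx y hy hxy
  · have := key y hy x hx hxy
    rw [abs_sub_comm (φ y) (φ x)] at this
    rw [← abs_neg]
    convert this using 2
    ring

/-- Nondiscreteness at `p` by elements moving `p`. -/
def Q (L : Subgroup Lf) (p : ℝ) : Prop :=
  ∃ δ > 0, ∀ η > 0, ∃ F ∈ L, F p ≠ p ∧ Cl F (Icc (p - δ) (p + δ)) η

theorem Q_of_fixed {L : Subgroup Lf} (hL : Good L) (hg : g ∈ L)
    (h : IsChart g p lam w φ D) {δ : ℝ} (hδ : 0 < δ)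
    (hF : ∀ η > 0, ∃ F ∈ L, F ≠ 1 ∧ F p = p ∧ Cl F (Icc (p - δ) (p + δ)) η) :
    ∃ w' > 0, ∀ p', p' ≠ p → |φ p'| < w' → Q L p' := by
  obtain ⟨w1, hw1, hw1w, hw1S⟩ := h.nhds (Icc_mem_nhds (by linarith : p - δ < p)
    (by linarith : p < p + δ))
  have hpI : p ∈ Icc (p - δ) (p + δ) := ⟨by linarith, by linarith⟩
  refine ⟨w1 / 2, by positivity, fun p' hp' hpw => ?_⟩
  -- neighborhood of p'
  have hnb : {x | |φ x| < w1 / 2} ∈ 𝓝 p' :=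
    (isOpen_lt h.cont.abs continuous_const).mem_nhds hpw
  obtain ⟨δ1, hδ1, hball⟩ := Metric.mem_nhds_iff.1 hnb
  refine ⟨δ1 / 2, by positivity, fun η hη => ?_⟩
  have hin : ∀ x ∈ Icc (p' - δ1 / 2) (p' + δ1 / 2), |φ x| < w1 / 2 := fun x hx => hball (by
    rw [Metric.mem_ball, Real.dist_eq, abs_lt]
    constructor <;> linarith [hx.1, hx.2])
  obtain ⟨m0, hm0, hexp⟩ := h.expand (p - δ) (p + δ)
  set ε0 := min (η / 8) (1 / 4) with hε0
  have hε0p : 0 < ε0 := by positivity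
  obtain ⟨η1, hη1, hrat⟩ := Dratio h.Dc h.Dpos (p - δ) (p + δ) hε0p
  -- chart closeness
  set ε := min 1 (min (η * m0 / w1) (η1 * m0 / w1)) with hε
  have hεp : 0 < ε := by positivity
  have hε1 : ε ≤ 1 := min_le_left _ _
  have hε2 : ε * w1 ≤ η * m0 := by
    rw [← le_div_iff₀ hw1]; exact (min_le_right _ _).trans (min_le_left _ _)
  have hε3 : ε * w1 ≤ η1 * m0 := by
    rw [← le_div_iff₀ hw1]; exact (min_le_right _ _).trans (min_le_right _ _)
  obtain ⟨η2, hη2, hlip⟩ := h.lip hL (p - δ) (p + δ) hεp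
  obtain ⟨F, hFL, hF1, hFp, hFcl⟩ := hF (min ε0 (min η1 η2)) (by positivity)
  have hlipF := hlip F hFL (fun x hx =>
    ⟨(hFcl x hx).1.trans ((min_le_right _ _).trans (min_le_right _ _)),
      (hFcl x hx).2.trans ((min_le_right _ _).trans (min_le_right _ _))⟩)
  have hφF : ∀ x, |φ x| ≤ w1 → |φ (F x) - φ x| ≤ ε * |φ x| := by
    intro x hx
    have := hlipF x (hw1S x hx) p hpI
    rw [hFp, h.zero, sub_zero, sub_zero] at this
    exact this
  -- choose m
  obtain ⟨m, hm⟩ : ∃ m : ℕ, F ((g ^ m : Lf) p') ≠ (g ^ m : Lf) p' := by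
    have hne := hL.ev_ne hFL (one_mem L) hF1 p
    rw [eventually_nhdsWithin_iff] at hne
    obtain ⟨w2, hw2, -, hw2S⟩ := h.nhds hne
    have hp0 : 0 < |φ p'| := abs_pos.2 fun h0 => hp' (h.mono.injective (by rw [h0, h.zero]))
    obtain ⟨m, hm⟩ := exists_pow_lt_of_lt_one (div_pos hw2 hp0) h.lam1
    rw [lt_div_iff₀ hp0] at hm
    have hit := (h.itlin m (x := p') (by linarith)).1
    refine ⟨m, hw2S _ ?_ ?_⟩
    · rw [hit, abs_mul, abs_of_pos (pow_pos h.lam0 m)]; exact hm.le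
    · intro he
      rw [he, h.zero] at hit
      have := mul_pos (pow_pos h.lam0 m) hp0
      rw [← abs_of_pos (pow_pos h.lam0 m), ← abs_mul, ← hit, abs_zero] at this
      exact lt_irrefl _ this
  set G : Lf := (g ^ m)⁻¹ * F * g ^ m with hG
  have hGL : G ∈ L := mul_mem (mul_mem (inv_mem (pow_mem hg m)) hFL) (pow_mem hg m)
  have hgG : ∀ x, (g ^ m : Lf) (G x) = F ((g ^ m : Lf) x) := fun x => by
    rw [hG, lmul, lmul, linv']
  refine ⟨G, hGL, fun he => hm (by rw [← hgG, he]), fun x hx => ?_⟩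
  have hx' := hin x hx
  have hlm := pow_pos h.lam0 m
  obtain ⟨hit1, hit2⟩ := h.itlin m (x := x) (by linarith)
  have hyw : |φ ((g ^ m : Lf) x)| ≤ w1 := by linarith
  have hu0 := hφF _ hyw
  set u := φ (F ((g ^ m : Lf) x)) / lam ^ m with hu
  have hu1 : φ (F ((g ^ m : Lf) x)) = lam ^ m * u := by rw [hu]; field_simp
  have hud : |u - φ x| ≤ ε * |φ x| := by
    rw [hu1, hit1, ← mul_sub, abs_mul, abs_mul, abs_of_pos hlm] at hu0
    have : lam ^ m * |u - φ x| ≤ lam ^ m * (ε * |φ x|) := by linarith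
    exact le_of_mul_le_mul_left this hlm
  have hud2 : ε * |φ x| ≤ ε * w1 := mul_le_mul_of_nonneg_left (by linarith) hεp.le
  have hud3 : ε * |φ x| ≤ |φ x| := mul_le_of_le_one_left (abs_nonneg _) hε1
  have huw : |u| ≤ w1 := by
    have := abs_sub_abs_le_abs_sub u (φ x)
    linarith
  have hGx : φ (G x) = u := h.conj F m (huw.trans hw1w) hu1
  have hxI := hw1S x (by linarith)
  have hGI := hw1S (G x) (by rw [hGx]; exact huw)
  have hyI := hw1S _ hyw
  have hGd : m0 * |G x - x| ≤ ε * w1 := by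
    have := hexp _ hGI _ hxI
    rw [hGx] at this
    linarith
  refine ⟨?_, ?_⟩
  · have : m0 * |G x - x| ≤ m0 * η := by linarith
    exact le_of_mul_le_mul_left this hm0
  · have r1 : |D (G x) - D x| ≤ ε0 * D x := by
      apply hrat x hxI
      have : m0 * |G x - x| ≤ m0 * η1 := by linarith
      exact le_of_mul_le_mul_left this hm0
    set y := (g ^ m : Lf) x with hy
    have r2 : |D (F y) - D y| ≤ ε0 * D y :=
      hrat y hyI _ ((hFcl y hyI).1.trans ((min_le_right _ _).trans (min_le_left _ _)))
    have r3 : |deriv F y - 1| ≤ ε0 := (hFcl y hyI).2.trans (min_le_left _ _)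
    have e1 : deriv (g ^ m : Lf) (G x) * deriv G x = deriv F y * deriv (g ^ m : Lf) x := by
      rw [← hL.dmul (pow_mem hg m) hGL, hy, ← hL.dmul hFL (pow_mem hg m)]
      congr 2
      rw [hG, mul_assoc, mul_inv_cancel_left]
    have e2 := h.itdlin hL hg m (x := x) (by linarith)
    have e3 := h.itdlin hL hg m (x := G x) (by rw [hGx]; linarith)
    rw [hgG, ← hy] at e3
    rw [← hy] at e2
    have e4 : D (G x) * deriv G x * D y = D (F y) * deriv F y * D x := by
      have : lam ^ m * (D (G x) * deriv G x * D y) = lam ^ m * (D (F y) * deriv F y * D x) := by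
        calc _ = (lam ^ m * D (G x)) * deriv G x * D y := by ring
          _ = D (F y) * D y * (deriv (g ^ m : Lf) (G x) * deriv G x) := by rw [← e3]; ring
          _ = D (F y) * deriv F y * (D y * deriv (g ^ m : Lf) x) := by rw [e1]; ring
          _ = _ := by rw [e2]; ring
      exact mul_left_cancel₀ hlm.ne' this
    have hDy := h.Dpos y
    have hDx := h.Dpos x
    have hDG := h.Dpos (G x)
    have hDF := h.Dpos (F y)
    have hFd := hL.dpos F hFL y
    have hGd := hL.dpos G hGL x
    have q4 : ε0 ≤ 1 / 4 := min_le_right _ _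
    have q8 : ε0 ≤ η / 8 := min_le_left _ _
    exact ratio_arith hDx hDy hDG hDF hFd hGd hε0p q4 q8 r1 r2 r3 e4

end

end RotImg

namespace RotImg

section
variable {g : Lf} {p lam w : ℝ} {φ D : ℝ → ℝ}

theorem IsChart.step {L : Subgroup Lf} (hL : Good L) (hg : g ∈ L)
    (h : IsChart g p lam w φ D) (hQ : Q L p) :
    ∃ w' > 0, ∀ e > 0, e ≤ w' / 8 → ∀ ζ > 0, ∃ t ∈ L, ∃ e', lam * e ≤ e' ∧ e' ≤ e ∧
      ∀ x, |φ x| ≤ w' / 4 → |φ (t x) - φ x - e'| ≤ ζ := by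
  obtain ⟨δ, hδ, hF⟩ := hQ
  obtain ⟨w', hw', hw'w, hw'S⟩ := h.nhds (Icc_mem_nhds (by linarith : p - δ < p)
    (by linarith : p < p + δ))
  have hpI : p ∈ Icc (p - δ) (p + δ) := ⟨by linarith, by linarith⟩
  refine ⟨w', hw', fun e he hew ζ0 hζ0 => ?_⟩
  obtain ⟨ζ, hζ, hζζ, hζw⟩ : ∃ ζ > 0, ζ ≤ ζ0 ∧ ζ ≤ w' / 16 :=
    ⟨min ζ0 (w' / 16), by positivity, min_le_left _ _, min_le_right _ _⟩
  suffices H : ∃ t ∈ L, ∃ e', lam * e ≤ e' ∧ e' ≤ e ∧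
      ∀ x, |φ x| ≤ w' / 4 → |φ (t x) - φ x - e'| ≤ ζ by
    obtain ⟨t, ht, e', h1, h2, h3⟩ := H
    exact ⟨t, ht, e', h1, h2, fun x hx => (h3 x hx).trans hζζ⟩
  have hη : 0 < ζ / w' := by positivity
  obtain ⟨η1, hη1, hlip⟩ := h.lip hL (p - δ) (p + δ) hη
  obtain ⟨η2, hη2, hsm⟩ : ∃ η2 > 0, ∀ y, |y - p| ≤ η2 → |φ y| ≤ e := by
    have := (h.cont.continuousAt (x := p)).abs.eventually_lt_const
      (show |φ p| < e by rw [h.zero, abs_zero]; exact he)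
    obtain ⟨η2, hη2, hh⟩ := Metric.eventually_nhds_iff.1 this
    refine ⟨η2 / 2, by positivity, fun y hy => (hh ?_).le⟩
    rw [Real.dist_eq]
    linarith
  obtain ⟨F, hFL, hFp, hFcl⟩ := hF (min η1 η2) (by positivity)
  have hlipF := hlip F hFL (fun x hx =>
    ⟨(hFcl x hx).1.trans (min_le_left _ _), (hFcl x hx).2.trans (min_le_left _ _)⟩)
  set a := φ (F p) with ha
  have ha0 : a ≠ 0 := fun h0 => hFp (h.mono.injective (by rw [h.zero]; exact h0))
  have hae : |a| ≤ e := hsm _ ((hFcl p hpI).1.trans (min_le_right _ _))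
  have hap : 0 < |a| := abs_pos.2 ha0
  obtain ⟨m, hm1, hm2⟩ := exists_nat_pow_near_of_lt_one (x := |a| / e) (by positivity)
    ((div_le_one he).2 hae) h.lam0 h.lam1
  have hlm := pow_pos h.lam0 m
  rw [lt_div_iff₀ he] at hm1
  rw [div_le_iff₀ he] at hm2
  set b := a / lam ^ m with hb
  have hab : a = lam ^ m * b := by rw [hb]; field_simp
  have hab' : |a| = lam ^ m * |b| := by rw [hab, abs_mul, abs_of_pos hlm]
  have hb1 : lam * e ≤ |b| := by
    have : lam ^ m * (lam * e) ≤ lam ^ m * |b| := by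
      rw [← hab', ← mul_assoc, ← pow_succ]; exact hm1.le
    exact le_of_mul_le_mul_left this hlm
  have hb2 : |b| ≤ e := by
    have : lam ^ m * |b| ≤ lam ^ m * e := by rw [← hab']; exact hm2
    exact le_of_mul_le_mul_left this hlm
  set t0 : Lf := (g ^ m)⁻¹ * F * g ^ m with ht0
  have htL : t0 ∈ L := mul_mem (mul_mem (inv_mem (pow_mem hg m)) hFL) (pow_mem hg m)
  have key : ∀ x, |φ x| ≤ w' / 2 → |φ (t0 x) - φ x - b| ≤ ζ := by
    intro x hx
    obtain ⟨hit1, hit2⟩ := h.itlin m (x := x) (by linarith)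
    have hl := hlipF _ (hw'S ((g ^ m : Lf) x) (by linarith)) p hpI
    set u := φ (F ((g ^ m : Lf) x)) / lam ^ m with hu
    have hu1 : φ (F ((g ^ m : Lf) x)) = lam ^ m * u := by rw [hu]; field_simp
    rw [h.zero, sub_zero, hit1, hu1, ← ha, hab] at hl
    have e1 : lam ^ m * u - lam ^ m * b - lam ^ m * φ x = lam ^ m * (u - φ x - b) := by ring
    rw [e1, abs_mul, abs_mul, abs_of_pos hlm] at hl
    have hl2 : |u - φ x - b| ≤ ζ / w' * |φ x| := by
      have : lam ^ m * |u - φ x - b| ≤ lam ^ m * (ζ / w' * |φ x|) := by linarith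
      exact le_of_mul_le_mul_left this hlm
    have hl3 : ζ / w' * |φ x| ≤ ζ := by
      calc ζ / w' * |φ x| ≤ ζ / w' * w' := mul_le_mul_of_nonneg_left (by linarith) hη.le
        _ = ζ := by field_simp
    have hl4 : |u - φ x - b| ≤ ζ := hl2.trans hl3
    have huw : |u| ≤ w := by
      rw [abs_le] at hl4 hx hb2 ⊢
      constructor <;> linarith
    rw [ht0, h.conj F m huw hu1]
    exact hl4
  rcases lt_or_gt_of_ne ha0 with hneg | hpos
  · have hbn : b < 0 := div_neg_of_neg_of_pos hneg hlm
    rw [abs_of_neg hbn] at hb1 hb2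
    refine ⟨t0⁻¹, inv_mem htL, -b, hb1, hb2, fun x hx => ?_⟩
    rw [abs_le] at hx
    obtain ⟨y1, hy1⟩ := h.surj (φ x - b + ζ)
    obtain ⟨y2, hy2⟩ := h.surj (φ x - b - ζ)
    have k1 := key y1 (by rw [hy1, abs_le]; constructor <;> linarith)
    have k2 := key y2 (by rw [hy2, abs_le]; constructor <;> linarith)
    rw [hy1, abs_le] at k1
    rw [hy2, abs_le] at k2
    have l1 : x ≤ t0 y1 := h.mono.le_iff_le.1 (by linarith [k1.1])
    have l2 : t0 y2 ≤ x := h.mono.le_iff_le.1 (by linarith [k2.2])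
    rw [← lle t0⁻¹, linv] at l1
    rw [← lle t0⁻¹, linv] at l2
    have l3 := h.mono.monotone l1
    have l4 := h.mono.monotone l2
    rw [abs_le]
    constructor <;> linarith
  · have hbp : 0 < b := div_pos hpos hlm
    rw [abs_of_pos hbp] at hb1 hb2
    exact ⟨t0, htL, b, hb1, hb2, fun x hx => key x (by linarith)⟩

theorem IsChart.transl {L : Subgroup Lf} (hL : Good L) (hg : g ∈ L)
    (h : IsChart g p lam w φ D) (hQ : Q L p) :
    ∃ w0 > 0, ∀ s, 0 ≤ s → s ≤ w0 → ∀ ε > 0, ∃ t ∈ L,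
      ∀ x, |φ x| ≤ w0 → |φ (t x) - φ x - s| ≤ ε := by
  obtain ⟨w', hw', hst⟩ := h.step hL hg hQ
  refine ⟨w' / 16, by positivity, fun s hs0 hs ε0 hε0 => ?_⟩
  obtain ⟨ε, hε, hεε, hεw⟩ : ∃ ε > 0, ε ≤ ε0 ∧ ε ≤ w' / 16 :=
    ⟨min ε0 (w' / 16), by positivity, min_le_left _ _, min_le_right _ _⟩
  have he : 0 < ε / 2 := by positivity
  have hlam := h.lam0
  have hR : 0 < s / (lam * (ε / 2)) + 1 := by positivity
  obtain ⟨t, htL, e', he1, he2, ht⟩ := hst (ε / 2) he (by linarith)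
    (ε / 2 / (s / (lam * (ε / 2)) + 1)) (by positivity)
  set ζ := ε / 2 / (s / (lam * (ε / 2)) + 1) with hζ
  have hζ0 : 0 < ζ := by positivity
  have he'0 : 0 < e' := lt_of_lt_of_le (by positivity) he1
  set k := ⌊s / e'⌋₊ with hk
  have hk1 : (k : ℝ) ≤ s / e' := Nat.floor_le (by positivity)
  have hk2 : s / e' < k + 1 := Nat.lt_floor_add_one _
  have hk3 : (k : ℝ) * e' ≤ s := by rwa [le_div_iff₀ he'0] at hk1
  have hk4 : s < (k + 1) * e' := by rwa [div_lt_iff₀ he'0] at hk2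
  have hkζ : k * ζ ≤ ε / 2 := by
    have h1 : (k : ℝ) ≤ s / (lam * (ε / 2)) + 1 := by
      have : s / e' ≤ s / (lam * (ε / 2)) := div_le_div_of_nonneg_left hs0 (by positivity) he1
      linarith
    calc k * ζ ≤ (s / (lam * (ε / 2)) + 1) * ζ := mul_le_mul_of_nonneg_right h1 hζ0.le
      _ = ε / 2 := by rw [hζ]; field_simp
  refine ⟨t ^ k, pow_mem htL k, fun x hx => ?_⟩
  have ind : ∀ j : ℕ, j ≤ k → |φ ((t ^ j : Lf) x) - φ x - j * e'| ≤ j * ζ := by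
    intro j
    induction j with
    | zero => intro _; rw [pow_zero, lone]; simp
    | succ j ih =>
      intro hj
      have h1 := ih (by omega)
      have hjk : (j : ℝ) ≤ k := by exact_mod_cast (by omega : j ≤ k)
      have h2 : (j : ℝ) * e' ≤ k * e' := mul_le_mul_of_nonneg_right hjk he'0.le
      have h3 : (j : ℝ) * ζ ≤ k * ζ := mul_le_mul_of_nonneg_right hjk hζ0.le
      have h4 : 0 ≤ (j : ℝ) * e' := by positivity
      rw [abs_le] at h1 hx
      have h5 := ht ((t ^ j : Lf) x) (by
        rw [abs_le]; constructor <;> linarith)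
      rw [← lpow_succ, abs_le] at h5
      rw [Nat.cast_succ, abs_le]
      constructor <;> linarith
  have h1 := ind k le_rfl
  rw [abs_le] at h1 ⊢
  constructor <;> linarith

end

/-- Every closed invariant set is everything. -/
def Min (L : Subgroup Lf) : Prop :=
  ∀ X : Set ℝ, IsClosed X → X.Nonempty → Inv L X → X = univ

theorem orbit_dense {L : Subgroup Lf} (hM : Min L) (x : ℝ) {a b : ℝ} (hab : a < b) :
    ∃ F ∈ L, F x ∈ Ioo a b := by
  have h1 := hM (closure {y | ∃ F ∈ L, F x = y}) isClosed_closure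
    ⟨x, subset_closure ⟨1, one_mem L, rfl⟩⟩ (by
      intro F hF y hy
      have : F y ∈ closure ((F : ℝ → ℝ) '' {y | ∃ F ∈ L, F x = y}) :=
        image_closure_subset_closure_image (lcont F) ⟨y, hy, rfl⟩
      refine closure_mono ?_ this
      rintro _ ⟨_, ⟨G, hG, rfl⟩, rfl⟩
      exact ⟨F * G, mul_mem hF hG, rfl⟩)
  have h2 : (a + b) / 2 ∈ closure {y | ∃ F ∈ L, F x = y} := by rw [h1]; exact mem_univ _
  rw [mem_closure_iff] at h2
  obtain ⟨_, hy, F, hF, rfl⟩ := h2 (Ioo a b) isOpen_Ioo ⟨by linarith, by linarith⟩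
  exact ⟨F, hF, hy⟩

/-- conjugation of hyperbolic fixed points -/
theorem hyp_conj {L : Subgroup Lf} (hL : Good L) {g k : Lf} (hg : g ∈ L) (hk : k ∈ L) {p : ℝ}
    (hp : g p = p) (hd : deriv g p < 1) :
    ∃ g' ∈ L, g' (k p) = k p ∧ deriv g' (k p) < 1 := by
  have hL' : k * g * k⁻¹ ∈ L := mul_mem (mul_mem hk hg) (inv_mem hk)
  have hfix : (k * g * k⁻¹ : Lf) (k p) = k p := by rw [lmul, lmul, linv, hp]
  refine ⟨k * g * k⁻¹, hL', hfix, ?_⟩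
  have h1 : deriv (k * g * k⁻¹ * k : Lf) p = deriv (k * g : Lf) p := by
    rw [inv_mul_cancel_right]
  rw [hL.dmul hL' hk, hL.dmul hk hg, hp, mul_comm] at h1
  have := mul_left_cancel₀ (hL.dpos k hk p).ne' h1
  rw [this]
  exact hd

theorem exists_Q {L : Subgroup Lf} (hL : Good L) (hM : Min L) {g : Lf} (hg : g ∈ L) {p : ℝ}
    (hp : g p = p) (hd : deriv g p < 1) {a0 b0 : ℝ} (hab : a0 < b0) (F : ℕ → Lf)
    (hF : ∀ n, F n ∈ L ∧ F n ≠ 1)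
    (hnd : ∀ ε > 0, ∃ N, ∀ n ≥ N, ∀ x ∈ Ioo a0 b0, |F n x - x| < ε ∧ |deriv (F n) x - 1| < ε) :
    ∃ g ∈ L, ∃ p, g p = p ∧ deriv g p < 1 ∧ Q L p := by
  obtain ⟨k, hk, hkI⟩ := orbit_dense hM p hab
  obtain ⟨g1, hg1, hg1p, hg1d⟩ := hyp_conj hL hg hk hp hd
  set q := k p with hq
  obtain ⟨δ, hδ, hδI⟩ : ∃ δ > 0, Icc (q - δ) (q + δ) ⊆ Ioo a0 b0 :=
    ⟨min (q - a0) (b0 - q) / 2,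
      half_pos (lt_min (by linarith [hkI.1]) (by linarith [hkI.2])), fun x hx => by
      have h1 := hkI.1
      have h2 := hkI.2
      have h3 := min_le_left (q - a0) (b0 - q)
      have h4 := min_le_right (q - a0) (b0 - q)
      constructor <;> linarith [hx.1, hx.2]⟩
  have hcl : ∀ η > 0, ∃ N, ∀ n ≥ N, Cl (F n) (Icc (q - δ) (q + δ)) η := by
    intro η hη
    obtain ⟨N, hN⟩ := hnd η hη
    exact ⟨N, fun n hn x hx => ⟨(hN n hn x (hδI hx)).1.le, (hN n hn x (hδI hx)).2.le⟩⟩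
  by_cases hinf : ∀ N, ∃ n ≥ N, F n q ≠ q
  · refine ⟨g1, hg1, q, hg1p, hg1d, δ, hδ, fun η hη => ?_⟩
    obtain ⟨N, hN⟩ := hcl η hη
    obtain ⟨n, hn, hne⟩ := hinf N
    exact ⟨F n, (hF n).1, hne, hN n hn⟩
  · push Not at hinf
    obtain ⟨N0, hN0⟩ := hinf
    obtain ⟨lam, w, φ, D, hch⟩ := linearize hL hg1 hg1p hg1d
    obtain ⟨w', hw', hQ⟩ := Q_of_fixed hL hg1 hch hδ (fun η hη => by
      obtain ⟨N, hN⟩ := hcl η hη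
      exact ⟨F (max N N0), (hF _).1, (hF _).2, hN0 _ (le_max_right _ _), hN _ (le_max_left _ _)⟩)
    obtain ⟨y, hy⟩ := hch.surj (w' / 2)
    have hqy : q < y := hch.mono.lt_iff_lt.1 (by rw [hch.zero, hy]; positivity)
    obtain ⟨l, hl, hlI⟩ := orbit_dense hM q hqy
    obtain ⟨g2, hg2, hg2p, hg2d⟩ := hyp_conj hL hg1 hl hg1p hg1d
    refine ⟨g2, hg2, l q, hg2p, hg2d, hQ _ hlI.1.ne' ?_⟩
    have h1 := hch.mono hlI.1
    have h2 := hch.mono hlI.2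
    rw [hch.zero] at h1
    rw [hy] at h2
    rw [abs_of_pos h1]
    linarith

end RotImg

namespace RotImg

/-- The interval from `x` to `y` can be contracted into any interval. -/
def Ct (L : Subgroup Lf) (x y : ℝ) : Prop := ∀ a b, a < b → ∃ γ ∈ L, a < γ x ∧ γ y < b

theorem Ct.mono {L : Subgroup Lf} {x y x' y' : ℝ} (h : Ct L x y) (hx : x ≤ x') (hy : y' ≤ y) :
    Ct L x' y' := by
  intro a b hab
  obtain ⟨γ, hγ, h1, h2⟩ := h a b hab
  exact ⟨γ, hγ, h1.trans_le ((lle γ).2 hx), ((lle γ).2 hy).trans_lt h2⟩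

theorem Ct.map {L : Subgroup Lf} {x y : ℝ} (h : Ct L x y) {k : Lf} (hk : k ∈ L) :
    Ct L (k x) (k y) := by
  intro a b hab
  obtain ⟨γ, hγ, h1, h2⟩ := h a b hab
  refine ⟨γ * k⁻¹, mul_mem hγ (inv_mem hk), ?_, ?_⟩
  · rwa [lmul, linv]
  · rwa [lmul, linv]

theorem Ct.lt {L : Subgroup Lf} {x y : ℝ} (h : Ct L x y) : y ≤ x + 1 := by
  by_contra hc
  obtain ⟨γ, -, h1, h2⟩ := h 0 1 one_pos
  have := (llt γ).2 (not_le.1 hc)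
  rw [ladd1] at this
  linarith

theorem Ct_chart {L : Subgroup Lf} (hM : Min L) {g : Lf} (hg : g ∈ L) {p lam w : ℝ}
    {φ D : ℝ → ℝ} (h : IsChart g p lam w φ D) {x y : ℝ} (hx : |φ x| ≤ w) (hy : |φ y| ≤ w) :
    Ct L x y := by
  intro a b hab
  obtain ⟨k, hk, hkI⟩ := orbit_dense hM p hab
  have hS : (k : ℝ → ℝ) ⁻¹' Ioo a b ∈ 𝓝 p := (lcont k).continuousAt (isOpen_Ioo.mem_nhds hkI)
  obtain ⟨w', hw', -, hw'S⟩ := h.nhds hS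
  obtain ⟨m, hm⟩ := exists_pow_lt_of_lt_one (div_pos hw' h.w0) h.lam1
  rw [lt_div_iff₀ h.w0] at hm
  have key : ∀ x, |φ x| ≤ w → k ((g ^ m : Lf) x) ∈ Ioo a b := by
    intro x hx
    apply hw'S
    rw [(h.itlin m hx).1, abs_mul, abs_of_pos (pow_pos h.lam0 m)]
    exact (mul_le_mul_of_nonneg_left hx (pow_pos h.lam0 m).le).trans hm.le
  exact ⟨k * g ^ m, mul_mem hk (pow_mem hg m), (key x hx).1, (key y hy).2⟩

/-- Local contractibility everywhere. -/
def LocCt (L : Subgroup Lf) : Prop := ∀ q, ∃ δ > 0, Ct L (q - δ) (q + δ)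

theorem locCt {L : Subgroup Lf} (hM : Min L) {g : Lf} (hg : g ∈ L) {p lam w : ℝ}
    {φ D : ℝ → ℝ} (h : IsChart g p lam w φ D) : LocCt L := by
  intro q
  obtain ⟨y, hy⟩ := h.surj w
  have hpy : p < y := h.mono.lt_iff_lt.1 (by rw [h.zero, hy]; exact h.w0)
  obtain ⟨k, hk, hkI⟩ := orbit_dense hM q hpy
  have hS : (k : ℝ → ℝ) ⁻¹' Ioo p y ∈ 𝓝 q := (lcont k).continuousAt (isOpen_Ioo.mem_nhds hkI)
  obtain ⟨δ', hδ', hb⟩ := Metric.mem_nhds_iff.1 hS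
  refine ⟨δ' / 2, by positivity, ?_⟩
  have key : ∀ x, |x - q| < δ' → |φ (k x)| ≤ w := by
    intro x hx
    have h0 : k x ∈ Ioo p y := hb (by rw [Metric.mem_ball, Real.dist_eq]; exact hx)
    have h1 := h.mono h0.1
    have h2 := h.mono h0.2
    rw [h.zero] at h1
    rw [abs_of_pos h1]
    linarith
  have h3 := Ct_chart hM hg h (key (q - δ' / 2) (by
      rw [abs_lt]; constructor <;> linarith)) (key (q + δ' / 2) (by
      rw [abs_lt]; constructor <;> linarith))
  have := h3.map (inv_mem hk)
  rwa [linv, linv] at this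

/-- The right end of the maximal contractible interval. -/
def th (L : Subgroup Lf) (x : ℝ) : ℝ := sSup {y | Ct L x y}

theorem th_bdd (L : Subgroup Lf) (x : ℝ) : BddAbove {y | Ct L x y} :=
  ⟨x + 1, fun _ hy => Ct.lt hy⟩

theorem le_th {L : Subgroup Lf} {x y : ℝ} (h : Ct L x y) : y ≤ th L x :=
  le_csSup (th_bdd L x) h

theorem lt_th {L : Subgroup Lf} (hl : LocCt L) (x : ℝ) : x < th L x := by
  obtain ⟨δ, hδ, h⟩ := hl x
  have := le_th (h.mono (by linarith : x - δ ≤ x) le_rfl)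
  linarith

theorem Ct_of_lt_th {L : Subgroup Lf} (hl : LocCt L) {x y : ℝ} (h : y < th L x) : Ct L x y := by
  obtain ⟨δ, hδ, h0⟩ := hl x
  obtain ⟨z, hz, hyz⟩ := exists_lt_of_lt_csSup
    ⟨x + δ, h0.mono (by linarith : x - δ ≤ x) le_rfl⟩ h
  exact Ct.mono hz le_rfl hyz.le

theorem th_mono {L : Subgroup Lf} (hl : LocCt L) : Monotone (th L) := by
  intro x y hxy
  apply le_of_forall_lt
  intro z hz
  by_contra hc
  obtain ⟨z', hz1, hz2⟩ := exists_between hz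
  have := le_th ((Ct_of_lt_th hl hz2).mono hxy le_rfl)
  linarith

theorem th_comm {L : Subgroup Lf} (hl : LocCt L) {F : Lf} (hF : F ∈ L) (x : ℝ) :
    th L (F x) = F (th L x) := by
  have key : ∀ F ∈ L, ∀ x, F (th L x) ≤ th L (F x) := by
    intro F hF x
    apply le_of_forall_lt
    intro z hz
    obtain ⟨z', hz1, hz2⟩ := exists_between hz
    have h1 : (F⁻¹ : Lf) z' < th L x := by rw [← llt F, linv']; exact hz2
    have h2 := le_th ((Ct_of_lt_th hl h1).map hF)
    rw [linv'] at h2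
    linarith
  apply le_antisymm _ (key F hF x)
  have := key F⁻¹ (inv_mem hF) (F x)
  rw [linv] at this
  rwa [← lle F, linv'] at this

theorem th_not_const {L : Subgroup Lf} (hl : LocCt L) {a b : ℝ} (hab : a < b) :
    ∃ r1 r2, a < r1 ∧ r1 < r2 ∧ r2 < b ∧ th L r1 < th L r2 := by
  by_contra hc
  push Not at hc
  have hconst : ∀ x y, x < y → Ct L x y → th L x = th L y := by
    intro x y hxy hC
    obtain ⟨γ, hγ, h1, h2⟩ := hC a b hab
    have h3 := hc (γ x) (γ y) h1 ((llt γ).2 hxy) h2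
    rw [th_comm hl hγ, th_comm hl hγ, lle] at h3
    exact le_antisymm (th_mono hl hxy.le) h3
  set q := th L 0 with hq
  have h0q : 0 < q := lt_th hl 0
  obtain ⟨δ, hδ, hC⟩ := hl q
  obtain ⟨y, hy1, hy2⟩ := exists_between (max_lt h0q (by linarith : q - δ < q))
  have h1 := hconst 0 y ((le_max_left _ _).trans_lt hy1) (Ct_of_lt_th hl hy2)
  have h2 := le_th (hC.mono ((le_max_right _ _).trans hy1.le) le_rfl)
  rw [← h1] at h2
  linarith

/-- An element below the identity on `[r₁, θ(r₁)]` is below the identity. -/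
theorem lt_id_of_lt {L : Subgroup Lf} (hl : LocCt L) {F : Lf} (hF : F ∈ L) {r1 : ℝ}
    (h : ∀ x ∈ Icc r1 (th L r1), F x < x) : ∀ x, F x < x := by
  by_contra hc
  push Not at hc
  obtain ⟨x1, hx1⟩ := hc
  have hr1 : F r1 < r1 := h r1 ⟨le_rfl, (lt_th hl r1).le⟩
  -- shift x1
  obtain ⟨n, hn⟩ := exists_nat_gt (r1 - x1)
  have hx2 : x1 + n ≤ F (x1 + n) := by
    have := laddz F x1 n
    push_cast at this
    rw [this]; linarith
  have hfx : ∃ x, x ∈ {x | r1 ≤ x ∧ F x = x} := by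
    have := intermediate_value_Icc (a := r1) (b := x1 + n) (by linarith)
      (f := fun x => F x - x) ((lcont F).sub continuous_id).continuousOn
    obtain ⟨x, hx, he⟩ := this (show (0 : ℝ) ∈ Icc _ _ from ⟨by linarith, by linarith⟩)
    exact ⟨x, hx.1, by dsimp only at he; linarith⟩
  have hclosed : IsClosed {x | r1 ≤ x ∧ F x = x} :=
    (isClosed_le continuous_const continuous_id).inter (isClosed_eq (lcont F) continuous_id)
  have hbd : BddBelow {x | r1 ≤ x ∧ F x = x} := ⟨r1, fun x hx => hx.1⟩
  have hmin := hclosed.csInf_mem hfx hbd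
  set x0 := sInf {x | r1 ≤ x ∧ F x = x} with hx0
  obtain ⟨hrx, hFx⟩ := hmin
  have hthx : th L r1 < x0 := by
    by_contra hcc
    have := h x0 ⟨hrx, not_lt.1 hcc⟩
    linarith
  set A := {w | th L w ≤ x0} with hA
  have hAr : r1 ∈ A := hthx.le
  have hAb : BddAbove A := ⟨x0, fun w hw => (lt_th hl w).le.trans hw⟩
  set u := sSup A with hu
  have hAF : ∀ w ∈ A, F w ∈ A := fun w hw => by
    show th L (F w) ≤ x0
    rw [th_comm hl hF, ← hFx, lle]; exact hw
  have hAF' : ∀ w ∈ A, (F⁻¹ : Lf) w ∈ A := fun w hw => by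
    show th L ((F⁻¹ : Lf) w) ≤ x0
    rw [th_comm hl (inv_mem hF), ← lle F, linv', hFx]; exact hw
  have hFu : F u = u := by
    apply le_antisymm
    · have : u ≤ (F⁻¹ : Lf) u := csSup_le ⟨r1, hAr⟩ fun w hw => by
        rw [← lle F, linv']; exact le_csSup hAb (hAF w hw)
      rwa [← lle F, linv'] at this
    · exact csSup_le ⟨r1, hAr⟩ fun w hw => by
        have := le_csSup hAb (hAF' w hw)
        rwa [← lle F, linv'] at this
  have hru : r1 ≤ u := le_csSup hAb hAr
  have hux : x0 ≤ u := csInf_le hbd ⟨hru, hFu⟩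
  obtain ⟨δ, hδ, hC⟩ := hl x0
  obtain ⟨w, hw, hw'⟩ := exists_lt_of_lt_csSup ⟨r1, hAr⟩ (show x0 - δ < sSup A by rw [← hu]; linarith)
  have h1 := le_th (hC.mono hw'.le le_rfl)
  have h2 : th L w ≤ x0 := hw
  linarith

end RotImg

namespace RotImg

theorem drift {φ : ℝ → ℝ} (hφ : StrictMono φ) (hφc : Continuous φ) (G : Lf) {r c s z : ℝ}
    (hz : r < z) (hzc : z ≤ c) (hs : φ z = φ (G z) + s) (j : ℕ) :
    ∀ y0 < z, ∃ κ0 > 0, ∀ κ, 0 < κ → κ ≤ κ0 → ∀ F : Lf,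
      (∀ y ∈ Icc r c, φ (G y) + s - 2 * κ ≤ φ (F y)) → y0 ≤ (F ^ j : Lf) z := by
  induction j with
  | zero => intro y0 hy; exact ⟨1, one_pos, fun κ _ _ F _ => by rw [pow_zero, lone]; exact hy.le⟩
  | succ j ih =>
    intro y0 hy0
    have h1 : φ y0 < φ (G z) + s := by rw [← hs]; exact hφ hy0
    have hc : Continuous fun y => φ (G y) + s := (hφc.comp (lcont G)).add continuous_const
    have h2 : ∀ᶠ y in 𝓝[<] z, φ y0 < φ (G y) + s ∧ r < y ∧ y < z := by
      have e1 : ∀ᶠ y in 𝓝[<] z, φ y0 < φ (G y) + s :=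
        ((hc.continuousAt (x := z)).eventually_const_lt h1).filter_mono nhdsWithin_le_nhds
      exact e1.and (Ioo_mem_nhdsLT hz)
    obtain ⟨y1, h3, h4, h5⟩ := h2.exists
    obtain ⟨κ0, hκ0, hh⟩ := ih y1 h5
    refine ⟨min κ0 ((φ (G y1) + s - φ y0) / 2), lt_min hκ0 (by linarith), fun κ hκ hκ' F hF => ?_⟩
    have h6 := hh κ hκ (hκ'.trans (min_le_left _ _)) F hF
    have h7 := hF y1 ⟨h4.le, h5.le.trans hzc⟩
    have h8 := hκ'.trans (min_le_right _ _)
    rw [lpow_succ]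
    refine le_trans ?_ ((lle F).2 h6)
    exact hφ.le_iff_le.1 (by linarith)

theorem main_rot {L : Subgroup Lf} (hL : Good L) (hM : Min L) {g : Lf} (hg : g ∈ L) {p : ℝ}
    (hp : g p = p) (hd : deriv g p < 1) (hQ : Q L p) (N : ℕ) :
    ∃ F ∈ L, (∀ x, F x < x) ∧ ∃ z, z - 1 ≤ (F ^ N : Lf) z := by
  obtain ⟨lam, w, φ, D, h⟩ := linearize hL hg hp hd
  have hl := locCt hM hg h
  obtain ⟨w1, hw1, htr⟩ := h.transl hL hg hQ
  obtain ⟨w0, hw0, hw0w, hw01⟩ : ∃ w0 > 0, w0 < w ∧ w0 ≤ w1 :=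
    ⟨min (w / 2) w1, lt_min (half_pos h.w0) hw1,
      (min_le_left _ _).trans_lt (half_lt_self h.w0), min_le_right _ _⟩
  have mono := h.mono
  have hww := h.w0
  choose ψ hψ using h.surj
  have hψm : ∀ {a b}, a < b → ψ a < ψ b := fun {a b} hab => mono.lt_iff_lt.1 (by rwa [hψ, hψ])
  have hthw : ψ w0 < th L (ψ (-w0)) := by
    have h1 := le_th (Ct_chart hM hg h (x := ψ (-w0)) (y := ψ w)
      (by rw [hψ, abs_neg, abs_of_pos hw0]; exact hw0w.le) (by rw [hψ, abs_of_pos hww]))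
    exact (hψm hw0w).trans_le h1
  set d := w0 / 10 with hdd
  have hd0 : 0 < d := by positivity
  obtain ⟨r1, r2, hr1, hr12, hr2, hth⟩ := th_not_const hl (hψm hd0)
  have hφ1 : 0 < φ r1 := by have := mono hr1; rwa [hψ] at this
  have hφ2 : φ r2 < d := by have := mono hr2; rwa [hψ] at this
  have hφ12 := mono hr12
  set c := ψ w0 with hc
  have hφc : φ c = w0 := hψ w0
  have hcth : c < th L r1 := hthw.trans_le (th_mono hl (by
    have : ψ (-w0) < ψ 0 := hψm (by linarith)
    linarith))
  obtain ⟨G, hG, hG1, hG2⟩ := Ct_of_lt_th hl hth (ψ (-d)) (ψ 0) (hψm (by linarith))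
  have hφG2 : -d < φ (G r2) := by have := mono hG1; rwa [hψ] at this
  have hφGt : φ (G (th L r1)) < 0 := by have := mono hG2; rwa [hψ] at this
  have hGr1 : G r1 < ψ (-w0) := by
    by_contra hcc
    have h1 := th_mono hl (not_lt.1 hcc)
    rw [th_comm hl hG] at h1
    have : ψ 0 < ψ w0 := hψm hw0
    linarith
  -- the point r
  set r := (G⁻¹ : Lf) (ψ (φ (G r2) - 2 * d)) with hr
  have hGr : φ (G r) = φ (G r2) - 2 * d := by rw [hr, linv', hψ]
  have hrr2 : r < r2 := by
    rw [← llt G]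
    exact mono.lt_iff_lt.1 (by rw [hGr]; linarith)
  have hrr1 : r1 < r := by
    rw [← llt G]
    refine hGr1.trans (mono.lt_iff_lt.1 ?_)
    rw [hGr, hψ]; linarith
  have hr2c : r2 < c := mono.lt_iff_lt.1 (by rw [hφc]; linarith)
  have hGneg : ∀ x, x ≤ th L r1 → φ (G x) < 0 := fun x hx =>
    (mono.monotone ((lle G).2 hx)).trans_lt hφGt
  -- minimum of the displacement
  obtain ⟨z, hz, hzmin⟩ := (isCompact_Icc (a := r) (b := c)).exists_isMinOn
    (nonempty_Icc.2 (by linarith)) (f := fun x => φ x - φ (G x))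
    (h.cont.sub (h.cont.comp (lcont G))).continuousOn
  set s := φ z - φ (G z) with hs
  have hmin : ∀ x ∈ Icc r c, s ≤ φ x - φ (G x) := fun x hx => hzmin hx
  have hs2 : s < 2 * d := by
    have := hmin r2 ⟨hrr2.le, hr2c.le⟩
    linarith
  have hs0 : 0 < s := by
    have h1 := hGneg z (hz.2.trans hcth.le)
    have h2 := mono.monotone hz.1
    have h3 := mono hrr1
    linarith
  have hzr : r < z := by
    refine lt_of_le_of_ne hz.1 fun he => ?_
    have h1 := hmin r2 ⟨hrr2.le, hr2c.le⟩
    rw [hs, ← he, hGr] at h1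
    have h3 := mono hrr1
    linarith
  obtain ⟨κ0, hκ0, hdr⟩ := drift mono h.cont G hzr hz.2 (s := s) (by rw [hs]; ring) N (z - 1)
    (by linarith)
  obtain ⟨κ, hκ, hκ1, hκ2⟩ : ∃ κ > 0, κ ≤ κ0 ∧ κ ≤ s :=
    ⟨min κ0 s, lt_min hκ0 hs0, min_le_left _ _, min_le_right _ _⟩
  obtain ⟨t, ht, htx⟩ := htr (s - κ) (by linarith) (by linarith) (κ / 2) (by positivity)
  have hFL : t * G ∈ L := mul_mem ht hG
  have hest : ∀ x, r ≤ x → x ≤ th L r1 → φ (G x) + s - 2 * κ ≤ φ ((t * G : Lf) x) ∧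
      φ ((t * G : Lf) x) < φ (G x) + s := by
    intro x hx1 hx2
    have h1 := hGneg x hx2
    have h2 := mono.monotone ((lle G).2 hx1)
    have h3 := abs_le.1 (htx (G x) (by rw [abs_le]; constructor <;> linarith))
    rw [lmul]
    constructor <;> linarith
  refine ⟨t * G, hFL, lt_id_of_lt hl hFL (r1 := r1) ?_, z, ?_⟩
  · intro x hx
    rw [← mono.lt_iff_lt]
    rcases le_total x r with hxr | hxr
    · have h1 := mono.monotone ((lle (t * G)).2 hxr)
      have h2 := (hest r le_rfl (by linarith)).2
      have h3 := mono.monotone hx.1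
      have h4 := hGneg r2 (by linarith)
      linarith
    · have h2 := (hest x hxr hx.2).2
      rcases le_total x c with hxc | hxc
      · have := hmin x ⟨hxr, hxc⟩
        linarith
      · have h3 := mono.monotone hxc
        have h4 := hGneg x hx.2
        linarith
  · exact hdr κ hκ hκ1 (t * G) fun y hy => (hest y hy.1 (by linarith [hy.2])).1

theorem tau_bounds {F : Lf} {N : ℕ} (hN : 0 < N) (h1 : ∀ x, F x < x)
    (h2 : ∃ z, z - 1 ≤ (F ^ N : Lf) z) :
    -(1 / (N : ℝ)) ≤ (F : CircleDeg1Lift).translationNumber ∧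
      (F : CircleDeg1Lift).translationNumber < 0 := by
  constructor
  · obtain ⟨z, hz⟩ := h2
    have h3 := CircleDeg1Lift.le_translationNumber_of_add_int_le
      ((F ^ N : Lf) : CircleDeg1Lift) (x := z) (m := -1)
      (by have h4 : ((-1 : ℤ) : ℝ) = -1 := by norm_num
          rw [h4]
          linarith)
    rw [Units.val_pow_eq_pow_val, CircleDeg1Lift.translationNumber_pow] at h3
    have h4 : ((-1 : ℤ) : ℝ) = -1 := by norm_num
    rw [h4] at h3
    have hN' : (0 : ℝ) < N := by exact_mod_cast hN
    rw [← neg_div, div_le_iff₀ hN']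
    linarith
  · have := CircleDeg1Lift.translationNumber_lt_of_forall_lt_add (F : CircleDeg1Lift) (lcont F) (z := 0)
      (fun x => by rw [add_zero]; exact h1 x)
    exact this

end RotImg

namespace RotImg

theorem rot_eq {F : Lf} {f : S1 ≃ₜ S1} (hF : IsLiftOf (F : CircleDeg1Lift) f) :
    rotationNumber f = (((F : CircleDeg1Lift).translationNumber : ℝ) : AddCircle (1 : ℝ)) := by
  have h : ∃ G : CircleDeg1Liftˣ, IsLiftOf (G : CircleDeg1Lift) f := ⟨F, hF⟩
  rw [rotationNumber, dif_pos h]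
  obtain ⟨n, hn⟩ := lift_diff h.choose_spec hF
  rw [hn]
  have h1 : ((trans n * F : Lf) : CircleDeg1Lift).translationNumber
      = n + (F : CircleDeg1Lift).translationNumber := by
    rw [Units.val_mul, CircleDeg1Lift.translationNumber_mul_of_commute, trans,
      CircleDeg1Lift.translationNumber_translate]
    · ext x
      change trans n (F x) = F (trans n x)
      rw [trans_apply, trans_apply]
      exact (CircleDeg1Lift.map_add_int _ _ _).symm
  rw [h1, AddCircle.coe_add]
  have h2 : (((n : ℤ) : ℝ) : AddCircle (1 : ℝ)) = 0 := by
    rw [AddCircle.coe_eq_zero_iff]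
    exact ⟨n, by simp⟩
  rw [h2, zero_add]

theorem ne_one {F : Lf} {f : S1 ≃ₜ S1} (hF : IsLiftOf (F : CircleDeg1Lift) f) (hf : f ≠ 1) :
    F ≠ 1 := by
  rintro rfl
  apply hf
  apply Homeomorph.ext
  intro x
  obtain ⟨y, rfl⟩ := QuotientAddGroup.mk_surjective x
  exact hF y

theorem exists_seq {Γ : Subgroup (S1 ≃ₜ S1)} (hΓ : ∀ f ∈ Γ, IsAnalyticDiffeo f)
    (hnd : LocallyC1Nondiscrete Γ) (hmeas : ¬ HasInvariantProbMeasure Γ) (N : ℕ) (hN : 0 < N) :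
    ∃ F ∈ lifts Γ, -(1 / (N : ℝ)) ≤ (F : CircleDeg1Lift).translationNumber ∧
      (F : CircleDeg1Lift).translationNumber < 0 := by
  have hL := lifts_good hΓ
  obtain ⟨a, b, hab, -, f, F, hfF, hn⟩ := hnd
  have hF : ∀ n, F n ∈ lifts Γ ∧ F n ≠ 1 := fun n =>
    ⟨⟨f n, (hfF n).1, (hfF n).2.2⟩, ne_one (hfF n).2.2 (hfF n).2.1⟩
  have hM : Min (lifts Γ) := minimal_case hL (no_finite hΓ hmeas) hab F hF (by
    intro ε hε
    obtain ⟨M, hM⟩ := hn ε hε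
    exact ⟨M, fun n hn x hx => (hM n hn x hx).1⟩)
  obtain ⟨S, c, hc, hSL, hA⟩ := claimA hΓ hmeas
  obtain ⟨g, hg, p, hp, hd⟩ := exists_hyperbolic hL S hc hSL hA
  obtain ⟨g, hg, p, hp, hd, hQ⟩ := exists_Q hL hM hg hp hd hab F hF hn
  obtain ⟨G, hG, h1, h2⟩ := main_rot hL hM hg hp hd hQ N
  exact ⟨G, hG, tau_bounds hN h1 h2⟩

theorem final {Γ : Subgroup (S1 ≃ₜ S1)} (hΓ : ∀ f ∈ Γ, IsAnalyticDiffeo f)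
    (hnd : LocallyC1Nondiscrete Γ) (hmeas : ¬ HasInvariantProbMeasure Γ) :
    ∃ f : ℕ → S1 ≃ₜ S1, (∀ i, f i ∈ Γ ∧ rotationNumber (f i) ≠ 0) ∧
      Tendsto (fun i => rotationNumber (f i)) atTop (𝓝 (0 : AddCircle (1 : ℝ))) := by
  have h := fun i : ℕ => exists_seq hΓ hnd hmeas (i + 2) (by omega)
  choose F hF h1 h2 using h
  choose f hf hfF using hF
  refine ⟨f, fun i => ⟨hf i, ?_⟩, ?_⟩
  · rw [rot_eq (hfF i), Ne, AddCircle.coe_eq_zero_iff]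
    rintro ⟨n, hn⟩
    have h3 := h1 i
    have h4 := h2 i
    rw [← hn] at h3 h4
    simp only [zsmul_eq_mul, mul_one] at h3 h4
    have h5 : n < 0 := by exact_mod_cast h4
    have h6 : (n : ℝ) ≤ -1 := by exact_mod_cast (by omega : n ≤ -1)
    have h7 : 1 / ((i + 2 : ℕ) : ℝ) < 1 := by
      rw [div_lt_one (by positivity)]
      push_cast
      have : (0 : ℝ) ≤ i := by positivity
      linarith
    linarith
  · have h3 : Tendsto (fun i => (F i : CircleDeg1Lift).translationNumber) atTop (𝓝 0) := by
      refine squeeze_zero_norm (a := fun i : ℕ => 1 / ((i : ℝ) + 1)) ?_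
        tendsto_one_div_add_atTop_nhds_zero_nat
      intro i
      rw [Real.norm_eq_abs, abs_of_neg (h2 i)]
      have h4 : 1 / ((i + 2 : ℕ) : ℝ) ≤ 1 / ((i : ℝ) + 1) := by
        apply one_div_le_one_div_of_le (by positivity)
        push_cast
        linarith
      linarith [h1 i]
    have h4 : Continuous (fun x : ℝ => (x : AddCircle (1 : ℝ))) := continuous_quotient_mk'
    have h5 := (h4.tendsto 0).comp h3
    have h6 : (fun i => rotationNumber (f i))
        = (fun x : ℝ => (x : AddCircle (1 : ℝ))) ∘ fun i => (F i : CircleDeg1Lift).translationNumber := by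
      funext i
      exact rot_eq (hfF i)
    rw [h6]
    exact h5

end RotImg

/-- (Proposition 4.1 of the paper.) A subgroup of `Diff^ω₊(S¹)` which is
locally nondiscrete in the `C¹`-topology and preserves no Borel probability measure has an
infinite image under the rotation number function; moreover there is a sequence of elements of
`Γ` with nonzero rotation numbers tending to `0`. -/
theorem infinite_rotation_image_of_locally_nondiscrete
    (Γ : Subgroup (S1 ≃ₜ S1)) (hΓ : ∀ f ∈ Γ, IsAnalyticDiffeo f)
    (hnd : LocallyC1Nondiscrete Γ) (hmeas : ¬ HasInvariantProbMeasure Γ) :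
    (rotationNumber '' (Γ : Set (S1 ≃ₜ S1))).Infinite ∧
    ∃ f : ℕ → S1 ≃ₜ S1, (∀ i, f i ∈ Γ ∧ rotationNumber (f i) ≠ 0) ∧
      Tendsto (fun i => rotationNumber (f i)) atTop (𝓝 (0 : AddCircle (1 : ℝ))) := by
  obtain ⟨f, hf, ht⟩ := RotImg.final hΓ hnd hmeas
  refine ⟨?_, f, hf, ht⟩
  intro hfin
  have h1 : IsClosed (rotationNumber '' (Γ : Set (S1 ≃ₜ S1)) \ {0}) :=
    (hfin.subset sdiff_subset).isClosed
  have h2 := ht.eventually (h1.isOpen_compl.mem_nhds (fun h => h.2 rfl))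
  obtain ⟨i, hi⟩ := h2.exists
  exact hi ⟨⟨f i, (hf i).1, rfl⟩, (hf i).2⟩


end
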